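/- arXiv:2112.04395 — 2 statements merged into one kernel-verified Lean document; each statement's English description precedes it below -/
import Mathlib

section
/- Let (S^↓_n) and (S^↑_n) be sequences of covering codes of lengths δ₁ = δ₁(n) and δ₂ = δ₂(n) respectively, each with asymptotically optimal density, and let A_n be the set of graphs G on [n] such that Y↓(G) ∈ S^↓_n, Y↑(G) ∈ S^↑_n, and Z(G) mod 4 ∈ {0,1}. Then n·(ln n) · P[G_n ∈ A_n] → 2 as n → ∞. -/
open Filter

/-- The degree of a vertex in a (possibly non-decidable) simple graph. -/
noncomputable def ndeg {V : Type*} (G : SimpleGraph V) (v : V) : ℕ :=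
  Nat.card (G.neighborSet v)

/-- The probability that a uniformly random graph on the (finite) vertex type `V`
belongs to the set `A`. -/
noncomputable def gprob {V : Type*} (A : Set (SimpleGraph V)) : ℝ :=
  (Nat.card A : ℝ) / 2 ^ (Nat.card V).choose 2

/-- The half-width `(1/2)·√(n·(ln n − 2·√(ln n)))` of the interval `D_n`. -/
noncomputable def bnd (n : ℕ) : ℝ :=
  (1 / 2) * Real.sqrt ((n : ℝ) * (Real.log n - 2 * Real.sqrt (Real.log n)))

/-- `d_*`: the smallest integer of `D_n = {d : |d − n/2| ≤ bnd n}`. -/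
noncomputable def dstar (n : ℕ) : ℤ := Int.ceil ((n : ℝ) / 2 - bnd n)

/-- `d^*`: the largest integer of `D_n`. -/
noncomputable def dtop (n : ℕ) : ℤ := Int.floor ((n : ℝ) / 2 + bnd n)

/-- `δ₁ = |D_{n,1}|`, the number of integers in `[d_*, ⌊n/2⌋ − 1]`. -/
noncomputable def delta1 (n : ℕ) : ℕ := (((n / 2 : ℕ) : ℤ) - dstar n).toNat

/-- `δ₂ = |D_{n,2}|`, the number of integers in `[⌊n/2⌋ + 1, d^*]`. -/
noncomputable def delta2 (n : ℕ) : ℕ := (dtop n - ((n / 2 : ℕ) : ℤ)).toNat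

/-- `X_y`: the number of vertices `v` with `d_* ≤ deg(v) ≤ y`. -/
noncomputable def Xcount {n : ℕ} (G : SimpleGraph (Fin n)) (y : ℤ) : ℕ :=
  Set.ncard {v : Fin n | dstar n ≤ (ndeg G v : ℤ) ∧ (ndeg G v : ℤ) ≤ y}

/-- `Y↓`: the vector of parities `(X_y mod 2)` for `y ∈ D_{n,1} = [d_*, ⌊n/2⌋ − 1]`. -/
noncomputable def Ydown {n : ℕ} (G : SimpleGraph (Fin n)) : Fin (delta1 n) → ZMod 2 :=
  fun j => (Xcount G (dstar n + (j : ℕ)) : ZMod 2)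

/-- `Y↑`: the vector of parities `(X_y mod 2)` for `y ∈ D_{n,2} = [⌊n/2⌋ + 1, d^*]`. -/
noncomputable def Yup {n : ℕ} (G : SimpleGraph (Fin n)) : Fin (delta2 n) → ZMod 2 :=
  fun j => (Xcount G (((n / 2 : ℕ) : ℤ) + 1 + (j : ℕ)) : ZMod 2)

/-- A covering code: every word of `{0,1}^m` is within Hamming distance 1 of a codeword. -/
def IsCoveringCode {m : ℕ} (S : Set (Fin m → ZMod 2)) : Prop :=
  ∀ x : Fin m → ZMod 2, ∃ c ∈ S, hammingDist x c ≤ 1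

/-- `N_y`: the number of vertices of degree `y` in a graph on `Fin n`. -/
noncomputable def Ncount {n : ℕ} (G : SimpleGraph (Fin n)) (y : ℤ) : ℕ :=
  Set.ncard {v : Fin n | (ndeg G v : ℤ) = y}

/-- `Z = Σ_{y ∈ D_{n,1} ∪ {⌊n/2⌋}} y·N_y`. -/
noncomputable def Zsum {n : ℕ} (G : SimpleGraph (Fin n)) : ℤ :=
  ∑ y ∈ Finset.Icc (dstar n) ((n / 2 : ℕ) : ℤ), y * (Ncount G y : ℤ)

open scoped symmDiff

section RandomGraph

variable {V : Type*}

theorem card_simpleGraph [Finite V] : Nat.card (SimpleGraph V) = 2 ^ (Nat.card V).choose 2 := by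
  classical
  have := Fintype.ofFinite V
  have e : SimpleGraph V ≃ Set {a : Sym2 V // ¬ a.IsDiag} :=
    { toFun := fun G => {a | a.1 ∈ G.edgeSet}
      invFun := fun s => SimpleGraph.fromEdgeSet (Subtype.val '' s)
      left_inv := by
        intro G
        ext x y
        simp only [SimpleGraph.fromEdgeSet_adj, Set.mem_image, Set.mem_ofPred_eq, Subtype.exists]
        constructor
        · rintro ⟨⟨a, _, h, rfl⟩, _⟩
          exact h
        · intro h
          exact ⟨⟨s(x, y), by simpa using h.ne, h, rfl⟩, h.ne⟩
      right_inv := by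
        intro s
        ext ⟨a, ha⟩
        simp [SimpleGraph.edgeSet_fromEdgeSet, ha] }
  rw [Nat.card_congr e, Nat.card_eq_fintype_card, Fintype.card_set, Sym2.card_subtype_not_diag,
    Nat.card_eq_fintype_card]

theorem gprob_eq [Finite V] (A : Set (SimpleGraph V)) :
    gprob A = (Nat.card A : ℝ) / Nat.card (SimpleGraph V) := by
  rw [gprob, card_simpleGraph]
  push_cast
  rfl

theorem gprob_mono [Finite V] {A B : Set (SimpleGraph V)} (h : A ⊆ B) : gprob A ≤ gprob B := by
  unfold gprob
  gcongr
  exact Nat.card_mono (Set.toFinite B) h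

theorem gprob_nonneg (A : Set (SimpleGraph V)) : 0 ≤ gprob A := by
  unfold gprob
  positivity

theorem gprob_union_le (A B : Set (SimpleGraph V)) : gprob (A ∪ B) ≤ gprob A + gprob B := by
  unfold gprob
  rw [← add_div]
  gcongr
  exact_mod_cast Set.ncard_union_le A B

theorem gprob_add_compl [Finite V] (A : Set (SimpleGraph V)) : gprob A + gprob Aᶜ = 1 := by
  rw [gprob_eq, gprob_eq, ← add_div, div_eq_one_iff_eq]
  · exact_mod_cast Set.ncard_add_ncard_compl A
  · exact_mod_cast Nat.card_pos.ne'

/-- Translating by a uniformly chosen member of a family of graphs preserves the uniform law. -/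
theorem card_mul_card_eq_sum_symmDiff {ι : Type*} [Finite ι] (A : Set (SimpleGraph V))
    [Fintype (SimpleGraph V)] (T : ι → SimpleGraph V) :
    (Nat.card A : ℝ) * Nat.card ι = ∑ G, (Nat.card {t // G ∆ T t ∈ A} : ℝ) := by
  classical
  have := Fintype.ofFinite ι
  have h : ∀ G, (Nat.card {t // G ∆ T t ∈ A} : ℝ) = ∑ t, if G ∆ T t ∈ A then (1 : ℝ) else 0 := by
    intro G
    rw [Nat.card_eq_fintype_card, Fintype.card_subtype]
    simp
  simp only [h]
  rw [Finset.sum_comm]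
  have h2 : ∀ t, (∑ G, if G ∆ T t ∈ A then (1 : ℝ) else 0) = Nat.card A := by
    intro t
    rw [(symmDiff_left_involutive (T t)).bijective.sum_comp (fun G => if G ∈ A then (1 : ℝ) else 0),
      Nat.card_eq_fintype_card, ← Set.toFinset_card]
    simp
  simp [h2, mul_comm]

theorem gprob_le_of_symmDiff [Finite V] {ι : Type*} [Finite ι] [Nonempty ι]
    {A K : Set (SimpleGraph V)}
    (T : ι → SimpleGraph V) {ε : ℝ} (hε : 0 ≤ ε)
    (h : ∀ G ∉ K, (Nat.card {t // G ∆ T t ∈ A} : ℝ) ≤ ε * Nat.card ι) :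
    gprob A ≤ gprob K + ε := by
  classical
  have := Fintype.ofFinite (SimpleGraph V)
  have hι : (0 : ℝ) < Nat.card ι := by exact_mod_cast Nat.card_pos
  have hΩ : (0 : ℝ) < Nat.card (SimpleGraph V) := by exact_mod_cast Nat.card_pos
  have key : (Nat.card A : ℝ) * Nat.card ι ≤
      (Nat.card K + ε * Nat.card (SimpleGraph V)) * Nat.card ι := by
    rw [card_mul_card_eq_sum_symmDiff A T]
    calc _ ≤ ∑ G : SimpleGraph V, ((if G ∈ K then (Nat.card ι : ℝ) else 0) + ε * Nat.card ι) := by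
          gcongr with G
          split_ifs with hG
          · have : (Nat.card {t // G ∆ T t ∈ A} : ℝ) ≤ Nat.card ι := by
              exact_mod_cast Finite.card_subtype_le _
            nlinarith
          · simpa using h G hG
      _ = _ := by
          rw [Finset.sum_add_distrib]
          simp only [Finset.sum_const, Finset.card_univ, nsmul_eq_mul, ← Finset.sum_filter]
          rw [Nat.card_eq_fintype_card (α := SimpleGraph V), Nat.card_eq_fintype_card (α := K),
            ← Set.toFinset_card]
          simp
          ring
  have := le_of_mul_le_mul_right key hι
  rw [gprob_eq, gprob_eq, div_le_iff₀ hΩ, add_mul, div_mul_cancel₀ _ hΩ.ne']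
  exact this

theorem gprob_eq_of_symmDiff [Finite V] {ι : Type*} [Finite ι] [Nonempty ι]
    {A W : Set (SimpleGraph V)}
    (T : ι → SimpleGraph V) {ρ : ℝ}
    (h : ∀ G ∈ W, (Nat.card {t // G ∆ T t ∈ A} : ℝ) = ρ * Nat.card ι)
    (h' : ∀ G ∉ W, ∀ t, G ∆ T t ∉ A) :
    gprob A = ρ * gprob W := by
  classical
  have := Fintype.ofFinite (SimpleGraph V)
  have hι : (0 : ℝ) < Nat.card ι := by exact_mod_cast Nat.card_pos
  have key : (Nat.card A : ℝ) * Nat.card ι = ρ * Nat.card W * Nat.card ι := by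
    rw [card_mul_card_eq_sum_symmDiff A T]
    calc _ = ∑ G : SimpleGraph V, (if G ∈ W then (ρ * Nat.card ι : ℝ) else 0) := by
          refine Finset.sum_congr rfl fun G _ => ?_
          split_ifs with hG
          · exact h G hG
          · have : IsEmpty {t // G ∆ T t ∈ A} := ⟨fun t => h' G hG t.1 t.2⟩
            simp
      _ = _ := by
          simp only [Finset.sum_const, nsmul_eq_mul, ← Finset.sum_filter]
          rw [Nat.card_eq_fintype_card (α := W), ← Set.toFinset_card]
          simp
          ring
  rw [gprob_eq, gprob_eq, mul_right_cancel₀ hι.ne' key, mul_div_assoc]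

/-- A probability-halving involution. -/
theorem two_mul_gprob_eq_of_involution [Finite V] {A B : Set (SimpleGraph V)}
    (τ : SimpleGraph V → SimpleGraph V)
    (hτB : ∀ G ∈ B, τ G ∈ B) (hinv : ∀ G ∈ B, τ (τ G) = G) (hAB : A ⊆ B)
    (hA : ∀ G ∈ B, τ G ∈ A ↔ G ∉ A) :
    2 * gprob A = gprob B := by
  have h1 : Nat.card A = Nat.card (B \ A : Set (SimpleGraph V)) := by
    refine Set.ncard_congr (fun G _ => τ G) ?_ ?_ ?_
    · intro G hG
      refine ⟨hτB G (hAB hG), fun h => ?_⟩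
      exact ((hA G (hAB hG)).1 h) hG
    · intro G G' hG hG' h
      rw [← hinv G (hAB hG), h, hinv G' (hAB hG')]
    · intro G hG
      exact ⟨τ G, (hA G hG.1).2 hG.2, hinv G hG.1⟩
  have h2 : Nat.card (B \ A : Set (SimpleGraph V)) + Nat.card A = Nat.card B :=
    Set.ncard_sdiff_add_ncard_of_subset hAB
  unfold gprob
  rw [← h2, ← h1]
  push_cast
  ring

end RandomGraph

section Matching

variable {V ι : Type*}

theorem symmDiff_adj (G H : SimpleGraph V) (x y : V) :
    (G ∆ H).Adj x y ↔ (G.Adj x y ↔ ¬ H.Adj x y) := by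
  rw [symmDiff_def, SimpleGraph.sup_adj, SimpleGraph.sdiff_adj, SimpleGraph.sdiff_adj]
  tauto

theorem bool_pair_ne (p : ι × Bool) : p ≠ (p.1, !p.2) := by
  rcases p with ⟨i, b⟩
  cases b <;> simp

/-- The number of neighbours of `φ p` other than its partner `φ (p.1, !p.2)`. -/
noncomputable def baseDeg (φ : ι × Bool ↪ V) (G : SimpleGraph V) (p : ι × Bool) : ℕ :=
  Set.ncard {w | G.Adj (φ p) w ∧ w ≠ φ (p.1, !p.2)}

/-- The matching consisting of the pairs `φ (i, true)`, `φ (i, false)` with `ξ i ≠ 0`. -/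
def matchingGraph (φ : ι × Bool ↪ V) (ξ : ι → ZMod 2) : SimpleGraph V where
  Adj x y := ∃ p : ι × Bool, ξ p.1 ≠ 0 ∧ x = φ p ∧ y = φ (p.1, !p.2)
  symm := ⟨by
    rintro x y ⟨⟨i, b⟩, h, hx, hy⟩
    exact ⟨(i, !b), h, hy, by simpa using hx⟩⟩
  loopless := ⟨by
    rintro x ⟨p, -, hx, hy⟩
    exact bool_pair_ne p (φ.injective (hx.symm.trans hy))⟩

theorem matchingGraph_adj (φ : ι × Bool ↪ V) (ξ : ι → ZMod 2) (p : ι × Bool) (w : V) :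
    (matchingGraph φ ξ).Adj (φ p) w ↔ ξ p.1 ≠ 0 ∧ w = φ (p.1, !p.2) := by
  constructor
  · rintro ⟨q, h, hq, hw⟩
    obtain rfl := φ.injective hq
    exact ⟨h, hw⟩
  · rintro ⟨h, hw⟩
    exact ⟨p, h, rfl, hw⟩

theorem not_matchingGraph_adj (φ : ι × Bool ↪ V) (ξ : ι → ZMod 2) {v : V}
    (hv : v ∉ Set.range φ) (w : V) : ¬ (matchingGraph φ ξ).Adj v w := by
  rintro ⟨q, -, hq, -⟩
  exact hv ⟨q, hq.symm⟩

theorem baseDeg_symmDiff_matchingGraph (φ : ι × Bool ↪ V) (G : SimpleGraph V) (ξ : ι → ZMod 2) :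
    baseDeg φ (G ∆ matchingGraph φ ξ) = baseDeg φ G := by
  funext p
  unfold baseDeg
  congr 1
  ext w
  simp only [Set.mem_ofPred_eq, symmDiff_adj, matchingGraph_adj]
  tauto

theorem ndeg_symmDiff_matchingGraph (φ : ι × Bool ↪ V) (G : SimpleGraph V) (ξ : ι → ZMod 2)
    {v : V} (hv : v ∉ Set.range φ) : ndeg (G ∆ matchingGraph φ ξ) v = ndeg G v := by
  have : (G ∆ matchingGraph φ ξ).neighborSet v = G.neighborSet v := by
    ext w
    simp [symmDiff_adj, not_matchingGraph_adj φ ξ hv]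
  rw [ndeg, ndeg, this]

open Classical in
theorem ndeg_eq_baseDeg_add [Finite V] (φ : ι × Bool ↪ V) (G : SimpleGraph V) (p : ι × Bool) :
    ndeg G (φ p) = baseDeg φ G p + if G.Adj (φ p) (φ (p.1, !p.2)) then 1 else 0 := by
  have h : ndeg G (φ p) = (G.neighborSet (φ p)).ncard := rfl
  rw [h, baseDeg]
  split_ifs with hadj
  · rw [← Set.ncard_insert_of_notMem (a := φ (p.1, !p.2)) (by simp)]
    congr 1
    ext w
    simp only [SimpleGraph.mem_neighborSet, Set.mem_insert_iff, Set.mem_ofPred_eq]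
    constructor
    · intro h
      by_cases hw : w = φ (p.1, !p.2)
      · exact Or.inl hw
      · exact Or.inr ⟨h, hw⟩
    · rintro (rfl | h)
      · exact hadj
      · exact h.1
  · rw [add_zero]
    congr 1
    ext w
    simp only [SimpleGraph.mem_neighborSet, Set.mem_ofPred_eq, ne_eq, iff_self_and]
    rintro h rfl
    exact hadj h

variable [Fintype V] [Fintype ι]

open Classical in
theorem sum_ndeg_eq {M : Type*} [AddCommMonoid M] (φ : ι × Bool ↪ V) (G : SimpleGraph V)
    (h : ℕ → M) :
    ∑ v, h (ndeg G v) = ∑ v with v ∉ Set.range φ, h (ndeg G v) +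
      ∑ i, (h (baseDeg φ G (i, true) + if G.Adj (φ (i, true)) (φ (i, false)) then 1 else 0) +
        h (baseDeg φ G (i, false) + if G.Adj (φ (i, true)) (φ (i, false)) then 1 else 0)) := by
  rw [add_comm, ← Finset.sum_filter_add_sum_filter_not Finset.univ (· ∈ Set.range φ)]
  congr 1
  have : Finset.univ.filter (· ∈ Set.range φ) = Finset.univ.map φ := by
    ext
    simp
  rw [this, Finset.sum_map, Fintype.sum_prod_type]
  refine Finset.sum_congr rfl fun i _ => ?_
  rw [Fintype.sum_bool, ndeg_eq_baseDeg_add, ndeg_eq_baseDeg_add]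
  simp [G.adj_comm (φ (i, false))]

/-- Toggling matching edges changes a parity statistic of the degree sequence linearly. -/
theorem sum_ndeg_symmDiff_matchingGraph (φ : ι × Bool ↪ V) (G : SimpleGraph V) (ξ : ι → ZMod 2)
    (h : ℕ → ZMod 2) :
    ∑ v, h (ndeg (G ∆ matchingGraph φ ξ) v) = ∑ v, h (ndeg G v) +
      ∑ i, ξ i * ((h (baseDeg φ G (i, true)) + h (baseDeg φ G (i, true) + 1)) +
        (h (baseDeg φ G (i, false)) + h (baseDeg φ G (i, false) + 1))) := by
  classical
  rw [sum_ndeg_eq φ, sum_ndeg_eq φ G, baseDeg_symmDiff_matchingGraph, add_assoc,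
    ← Finset.sum_add_distrib]
  congr 1
  · refine Finset.sum_congr rfl fun v hv => ?_
    rw [ndeg_symmDiff_matchingGraph]
    simpa using hv
  · refine Finset.sum_congr rfl fun i _ => ?_
    generalize baseDeg φ G (i, true) = a
    generalize baseDeg φ G (i, false) = b
    have hc : ∀ x : ZMod 2, x = 0 ∨ x = 1 := by decide
    simp only [symmDiff_adj, matchingGraph_adj, Bool.not_true, and_true]
    rcases hc (ξ i) with h0 | h0 <;> by_cases h1 : G.Adj (φ (i, true)) (φ (i, false)) <;>
      simp only [h0, h1] <;> simp <;> generalize h a = x <;> generalize h b = y <;>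
      generalize h (a + 1) = z <;> generalize h (b + 1) = w <;> revert x y z w <;> decide

theorem sum_ndeg_symmDiff_matchingGraph_single [DecidableEq ι] (φ : ι × Bool ↪ V)
    (G : SimpleGraph V) (h : ℕ → ℤ) (i : ι) (h1 : baseDeg φ G (i, true) = baseDeg φ G (i, false))
    (h2 : h (baseDeg φ G (i, false) + 1) = h (baseDeg φ G (i, false)) + 1) :
    ∑ v, h (ndeg (G ∆ matchingGraph φ (Pi.single i 1)) v) = ∑ v, h (ndeg G v) + 2 ∨
      ∑ v, h (ndeg (G ∆ matchingGraph φ (Pi.single i 1)) v) = ∑ v, h (ndeg G v) - 2 := by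
  classical
  rw [sum_ndeg_eq φ, sum_ndeg_eq φ G, baseDeg_symmDiff_matchingGraph]
  have e1 : ∑ v with v ∉ Set.range φ, h (ndeg (G ∆ matchingGraph φ (Pi.single i 1)) v) =
      ∑ v with v ∉ Set.range φ, h (ndeg G v) := by
    refine Finset.sum_congr rfl fun v hv => ?_
    rw [ndeg_symmDiff_matchingGraph]
    simpa using hv
  rw [e1, ← Finset.add_sum_erase _ _ (Finset.mem_univ i),
    ← Finset.add_sum_erase (a := i) Finset.univ (fun i => h (baseDeg φ G (i, true) + _) + _)
      (Finset.mem_univ i)]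
  have e2 : ∀ j ∈ Finset.univ.erase i, ((G ∆ matchingGraph φ (Pi.single i 1)).Adj (φ (j, true))
      (φ (j, false)) ↔ G.Adj (φ (j, true)) (φ (j, false))) := by
    intro j hj
    simp [symmDiff_adj, matchingGraph_adj, Finset.ne_of_mem_erase hj]
  have e3 : ∀ c : ι → Bool → ℕ,
      ∑ j ∈ Finset.univ.erase i, (h (c j true + if (G ∆ matchingGraph φ (Pi.single i 1)).Adj
          (φ (j, true)) (φ (j, false)) then 1 else 0) + h (c j false +
          if (G ∆ matchingGraph φ (Pi.single i 1)).Adj (φ (j, true)) (φ (j, false)) then 1 else 0)) =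
      ∑ j ∈ Finset.univ.erase i, (h (c j true + if G.Adj (φ (j, true)) (φ (j, false))
          then 1 else 0) + h (c j false + if G.Adj (φ (j, true)) (φ (j, false)) then 1 else 0)) :=
    fun c => Finset.sum_congr rfl fun j hj => by simp only [e2 j hj]
  rw [e3 (fun j b => baseDeg φ G (j, b))]
  simp only [symmDiff_adj, matchingGraph_adj, Bool.not_true, and_true, Pi.single_eq_same, h1]
  by_cases h3 : G.Adj (φ (i, true)) (φ (i, false))
  · right
    simp [h3, h2]
    ring
  · left
    simp [h3, h2]
    ring

end Matching

section Uniformity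

theorem card_preimage_add_mul_card {A B : Type*} [AddCommGroup A] [AddCommGroup B] [Finite A]
    [Finite B] (L : A →+ B) (hL : Function.Surjective L) (y : B) (S : Set B) :
    Nat.card {x // y + L x ∈ S} * Nat.card B = Nat.card S * Nat.card A := by
  classical
  have := Fintype.ofFinite A
  have := Fintype.ofFinite B
  obtain ⟨k, hk⟩ : ∃ k, ∀ b, (Finset.univ.filter fun x => y + L x = b).card = k := by
    refine ⟨(Finset.univ.filter fun x => L x = 0).card, fun b => ?_⟩
    rw [← AddMonoidHom.card_fiber_eq_of_mem_range L (x := b - y) (hL _) (hL _)]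
    simp [eq_sub_iff_add_eq, add_comm]
  have h1 : ∀ s : Finset B, (Finset.univ.filter fun x => y + L x ∈ s).card = s.card * k := by
    intro s
    rw [Finset.card_eq_sum_card_fiberwise (f := fun x => y + L x) (t := s) (by intro x; simp)]
    rw [← smul_eq_mul, ← Finset.sum_const]
    refine Finset.sum_congr rfl fun b hb => ?_
    rw [← hk b, Finset.filter_filter]
    congr 1
    ext x
    simp only [Finset.mem_filter, Finset.mem_univ, true_and, and_iff_right_iff_imp]
    rintro rfl
    exact hb
  have h2 := h1 Finset.univ
  have h3 := h1 S.toFinset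
  simp only [Finset.mem_univ, Finset.filter_true, Finset.card_univ, Set.mem_toFinset,
    Set.toFinset_card] at h2 h3
  rw [Nat.card_eq_fintype_card, Nat.card_eq_fintype_card, Nat.card_eq_fintype_card,
    Nat.card_eq_fintype_card, Fintype.card_subtype, h3, h2]
  ring

variable {V ι J : Type*} [Fintype V] [Fintype ι]

/-- If toggling matching edges spans all parity vectors, then the parity vector is uniform. -/
theorem gprob_parity_mem [Fintype J] [DecidableEq J] (φ : ι × Bool ↪ V) (h : J → ℕ → ZMod 2)
    (P : (ι × Bool → ℕ) → Prop)
    (hP : ∀ a, P a → ∀ j, ∃ i i', ∀ j',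
      ((h j' (a (i, true)) + h j' (a (i, true) + 1)) +
        (h j' (a (i, false)) + h j' (a (i, false) + 1))) +
      ((h j' (a (i', true)) + h j' (a (i', true) + 1)) +
        (h j' (a (i', false)) + h j' (a (i', false) + 1))) = (Pi.single j 1 : J → ZMod 2) j')
    (S : Set (J → ZMod 2)) :
    gprob {G : SimpleGraph V | P (baseDeg φ G) ∧ (fun j => ∑ v, h j (ndeg G v)) ∈ S} =
      (Nat.card S / 2 ^ Fintype.card J : ℝ) * gprob {G : SimpleGraph V | P (baseDeg φ G)} := by
  classical
  refine gprob_eq_of_symmDiff (matchingGraph φ) (fun G hG => ?_) (fun G hG ξ hξ => ?_)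
  · set a := baseDeg φ G with ha
    let L : (ι → ZMod 2) →+ (J → ZMod 2) :=
      { toFun := fun ξ j => ∑ i, ξ i * ((h j (a (i, true)) + h j (a (i, true) + 1)) +
          (h j (a (i, false)) + h j (a (i, false) + 1)))
        map_zero' := by
          funext j
          simp
        map_add' := by
          intro x y
          funext j
          simp [add_mul, Finset.sum_add_distrib] }
    have hLs : ∀ i j, L (Pi.single i 1) j = (h j (a (i, true)) + h j (a (i, true) + 1)) +
          (h j (a (i, false)) + h j (a (i, false) + 1)) := by
      intro i j
      change ∑ i', _ = _
      rw [Finset.sum_eq_single i]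
      · simp
      · intro b _ hb
        simp [hb]
      · simp
    have hL : Function.Surjective L := by
      have hsingle : ∀ j, ∃ x, L x = Pi.single j 1 := by
        intro j
        obtain ⟨i, i', hi⟩ := hP a hG j
        refine ⟨Pi.single i 1 + Pi.single i' 1, ?_⟩
        funext j'
        rw [map_add, Pi.add_apply, hLs, hLs, hi]
      choose x hx using hsingle
      intro y
      have hc : ∀ t : ZMod 2, t = 0 ∨ t = 1 := by decide
      refine ⟨∑ j with y j = 1, x j, ?_⟩
      rw [map_sum]
      funext j
      simp only [hx, Finset.sum_apply, Finset.sum_filter, Pi.single_apply]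
      rcases hc (y j) with h0 | h0
      · rw [h0]
        refine Finset.sum_eq_zero fun j' _ => ?_
        by_cases e : j = j'
        · subst e
          simp [h0]
        · simp [e]
      · rw [Finset.sum_eq_single j]
        · simp [h0]
        · intro b _ hb
          simp [hb.symm]
        · simp
    have key := card_preimage_add_mul_card L hL (fun j => ∑ v, h j (ndeg G v)) S
    have hset : ∀ ξ, G ∆ matchingGraph φ ξ ∈ {G : SimpleGraph V | P (baseDeg φ G) ∧
        (fun j => ∑ v, h j (ndeg G v)) ∈ S} ↔ (fun j => ∑ v, h j (ndeg G v)) + L ξ ∈ S := by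
      intro ξ
      have hG' : P (baseDeg φ G) := hG
      rw [Set.mem_ofPred_eq, baseDeg_symmDiff_matchingGraph, and_iff_right hG']
      simp only [sum_ndeg_symmDiff_matchingGraph]
      rfl
    rw [Nat.card_congr (Equiv.subtypeEquivRight hset), div_mul_eq_mul_div,
      eq_div_iff (by positivity)]
    have hcard : Nat.card (J → ZMod 2) = 2 ^ Fintype.card J := by
      rw [Nat.card_eq_fintype_card, Fintype.card_fun, ZMod.card]
    rw [hcard] at key
    exact_mod_cast key
  · rw [Set.mem_ofPred_eq, baseDeg_symmDiff_matchingGraph] at hξ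
    exact hG hξ.1

/-- If a matching edge can always be toggled so as to shift `Z` by `2` while preserving all
parities, then the two residues `0, 1` modulo `4` carry half of the mass. -/
theorem two_mul_gprob_parity_mem_and_mod_four (φ : ι × Bool ↪ V) (h : J → ℕ → ZMod 2) (z : ℕ → ℤ)
    (P : (ι × Bool → ℕ) → Prop)
    (hP : ∀ a, P a → ∃ i, a (i, true) = a (i, false) ∧ z (a (i, false) + 1) = z (a (i, false)) + 1)
    (S : Set (J → ZMod 2)) :
    2 * gprob {G : SimpleGraph V | (P (baseDeg φ G) ∧ (fun j => ∑ v, h j (ndeg G v)) ∈ S) ∧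
      ((∑ v, z (ndeg G v)) % 4 = 0 ∨ (∑ v, z (ndeg G v)) % 4 = 1)} =
    gprob {G : SimpleGraph V | P (baseDeg φ G) ∧ (fun j => ∑ v, h j (ndeg G v)) ∈ S} := by
  classical
  let ξ : (ι × Bool → ℕ) → ι → ZMod 2 := fun a =>
    if ha : P a then Pi.single (hP a ha).choose 1 else 0
  have hpar : ∀ G : SimpleGraph V, P (baseDeg φ G) →
      (fun j => ∑ v, h j (ndeg (G ∆ matchingGraph φ (ξ (baseDeg φ G))) v)) =
        fun j => ∑ v, h j (ndeg G v) := by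
    intro G hG
    funext j
    rw [sum_ndeg_symmDiff_matchingGraph, add_eq_left]
    simp only [ξ, dif_pos hG]
    have hc := (hP _ hG).choose_spec.1
    set i := (hP _ hG).choose
    refine Finset.sum_eq_zero fun i' _ => ?_
    by_cases e : i' = i
    · subst e
      rw [hc, CharTwo.add_self_eq_zero, mul_zero]
    · simp [e]
  refine two_mul_gprob_eq_of_involution (fun G => G ∆ matchingGraph φ (ξ (baseDeg φ G)))
    ?_ ?_ (fun G hG => hG.1) ?_
  · rintro G ⟨hG, hS⟩
    refine ⟨?_, ?_⟩
    · rwa [baseDeg_symmDiff_matchingGraph]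
    · rwa [hpar G hG]
  · rintro G ⟨hG, hS⟩
    simp only [baseDeg_symmDiff_matchingGraph]
    exact symmDiff_symmDiff_cancel_right _ _
  · rintro G ⟨hG, hS⟩
    simp only [Set.mem_ofPred_eq, baseDeg_symmDiff_matchingGraph]
    rw [hpar G hG]
    simp only [hG, hS, true_and]
    have hs := (hP _ hG).choose_spec
    have := sum_ndeg_symmDiff_matchingGraph_single φ G z _ hs.1 hs.2
    simp only [ξ, dif_pos hG]
    omega

end Uniformity

section Randomization

variable {V ι : Type*}

/-- The graph joining each `φ p` to the elements of `t p`. -/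
def spokeGraph (φ : ι × Bool ↪ V) (t : ι × Bool → Set V) : SimpleGraph V :=
  SimpleGraph.fromRel fun x y => ∃ p, x = φ p ∧ y ∈ t p

theorem spokeGraph_adj (φ : ι × Bool ↪ V) (t : ι × Bool → Set V) (p : ι × Bool) (w : V) :
    (spokeGraph φ t).Adj (φ p) w ↔ φ p ≠ w ∧ (w ∈ t p ∨ ∃ q, w = φ q ∧ φ p ∈ t q) := by
  simp only [spokeGraph, SimpleGraph.fromRel_adj]
  refine and_congr_right fun _ => or_congr ⟨?_, fun h => ⟨p, rfl, h⟩⟩ Iff.rfl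
  rintro ⟨q, hq, h⟩
  rwa [φ.injective hq]

/-- The number of neighbours of `φ p` in the range of `φ`, other than its partner. -/
noncomputable def innerDeg (φ : ι × Bool ↪ V) (G : SimpleGraph V) (p : ι × Bool) : ℕ :=
  Set.ncard {w | (G.Adj (φ p) w ∧ w ≠ φ (p.1, !p.2)) ∧ w ∈ Set.range φ}

theorem card_filter_card_symmDiff_eq {β : Type*} [Fintype β] [DecidableEq β] (N : Finset β)
    {s k : ℕ} (h : s ≤ k) :
    (Finset.univ.filter fun g : Finset β => s + (N ∆ g).card = k).card =
      (Fintype.card β).choose (k - s) := by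
  rw [← Finset.card_univ, ← Finset.card_powersetCard]
  refine Finset.card_bij (fun g _ => N ∆ g) ?_ ?_ ?_
  · intro g hg
    simp only [Finset.mem_filter, Finset.mem_univ, true_and] at hg
    simp only [Finset.mem_powersetCard, Finset.subset_univ, true_and]
    omega
  · intro g _ g' _ h
    exact symmDiff_right_injective N h
  · intro g hg
    simp only [Finset.mem_powersetCard, Finset.subset_univ, true_and] at hg
    refine ⟨N ∆ g, ?_, symmDiff_symmDiff_cancel_left N g⟩
    simp only [Finset.mem_filter, Finset.mem_univ, true_and, symmDiff_symmDiff_cancel_left]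
    omega

/-- Independent trials with success probability at least `q` all fail with probability at most
`exp (-q m)`. -/
theorem card_forall_notMem_le {ι X : Type*} [Fintype ι] [Finite X] (E : ι → Set X) (q : ℝ)
    (h : ∀ i, q * Nat.card X ≤ Nat.card (E i)) :
    (Nat.card {f : ι → X // ∀ i, f i ∉ E i} : ℝ) ≤
      Real.exp (-(q * Fintype.card ι)) * Nat.card (ι → X) := by
  have e : {f : ι → X // ∀ i, f i ∉ E i} ≃ (∀ i, {x // x ∉ E i}) :=
    Equiv.subtypePiEquivPi (p := fun i x => x ∉ E i)
  rw [Nat.card_congr e, Nat.card_pi, Nat.card_pi]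
  push_cast
  have : Real.exp (-(q * Fintype.card ι)) = ∏ _i : ι, Real.exp (-q) := by
    rw [Finset.prod_const, Finset.card_univ, ← Real.exp_nat_mul]
    congr 1
    ring
  rw [this, ← Finset.prod_mul_distrib]
  refine Finset.prod_le_prod (fun _ _ => by positivity) fun i _ => ?_
  have h1 : (Nat.card (E i) : ℝ) + Nat.card {x // x ∉ E i} = Nat.card X := by
    exact_mod_cast Set.ncard_add_ncard_compl (E i)
  have h2 := Real.one_sub_le_exp_neg q
  have h3 : (0 : ℝ) ≤ Nat.card X := by positivity
  nlinarith [h i]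

variable [Fintype V] [Fintype ι]

open Classical in
/-- The random spokes leaving the range of `φ` determined by `f`. -/
def outerSpokes (φ : ι × Bool ↪ V)
    (f : ι → Finset {v // v ∉ Set.range φ} × Finset {v // v ∉ Set.range φ}) :
    ι × Bool → Finset {v // v ∉ Set.range φ} :=
  fun p => bif p.2 then (f p.1).1 else (f p.1).2

open Classical in
theorem baseDeg_symmDiff_spokeGraph (φ : ι × Bool ↪ V) (G : SimpleGraph V)
    (f : ι × Bool → Finset {v // v ∉ Set.range φ}) (p : ι × Bool) :
    baseDeg φ (G ∆ spokeGraph φ fun p => Subtype.val '' (f p : Set {v // v ∉ Set.range φ})) p =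
      innerDeg φ G p + ((Finset.univ.filter fun w : {v // v ∉ Set.range φ} =>
        G.Adj (φ p) w) ∆ f p).card := by
  set N := Finset.univ.filter fun w : {v // v ∉ Set.range φ} => G.Adj (φ p) w with hN
  have hout : (N ∆ f p).card = (Subtype.val '' ((N ∆ f p : Finset {v // v ∉ Set.range φ}) :
      Set {v // v ∉ Set.range φ})).ncard := by
    rw [Set.ncard_image_of_injective _ Subtype.val_injective, Set.ncard_coe_finset]
  have hadj : ∀ w, (spokeGraph φ fun p => Subtype.val '' (f p : Set {v // v ∉ Set.range φ})).Adj
      (φ p) w ↔ ∃ h : w ∉ Set.range φ, (⟨w, h⟩ : {v // v ∉ Set.range φ}) ∈ f p := by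
    intro w
    rw [spokeGraph_adj]
    constructor
    · rintro ⟨-, ⟨⟨w, hw⟩, h, rfl⟩ | ⟨q, -, ⟨w', hw'⟩, -, h⟩⟩
      · exact ⟨hw, h⟩
      · exact absurd ⟨p, h.symm⟩ hw'
    · rintro ⟨hw, h⟩
      exact ⟨fun h' => hw ⟨p, h'⟩, Or.inl ⟨⟨w, hw⟩, h, rfl⟩⟩
  rw [hout, innerDeg, baseDeg, ← Set.ncard_union_eq]
  · congr 1
    ext w
    simp only [Set.mem_ofPred_eq, Set.mem_union, symmDiff_adj, hadj, Set.mem_image,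
      Finset.mem_coe, Finset.mem_symmDiff, hN, Finset.mem_filter, Finset.mem_univ, true_and]
    by_cases hw : w ∈ Set.range φ
    · have : ¬ ∃ x : {v // v ∉ Set.range φ},
          (G.Adj (φ p) x ∧ x ∉ f p ∨ x ∈ f p ∧ ¬ G.Adj (φ p) x) ∧ x.1 = w := by
        rintro ⟨⟨x, hx⟩, -, rfl⟩
        exact hx hw
      simp only [hw, this, not_true, IsEmpty.exists_iff, not_false_eq_true, iff_true, and_true,
        or_false]
    · have hne : w ≠ φ (p.1, !p.2) := by
        rintro rfl
        exact hw ⟨_, rfl⟩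
      have h2 : (∃ x : {v // v ∉ Set.range φ},
          (G.Adj (φ p) x ∧ x ∉ f p ∨ x ∈ f p ∧ ¬ G.Adj (φ p) x) ∧ x.1 = w) ↔
          (G.Adj (φ p) w ∧ (⟨w, hw⟩ : {v // v ∉ Set.range φ}) ∉ f p ∨
            (⟨w, hw⟩ : {v // v ∉ Set.range φ}) ∈ f p ∧ ¬ G.Adj (φ p) w) := by
        constructor
        · rintro ⟨⟨x, hx⟩, h, rfl⟩
          exact h
        · intro h
          exact ⟨⟨w, hw⟩, h, rfl⟩
      rw [h2]
      simp only [hw, hne, not_false_eq_true, ne_eq, and_true, and_false, false_or, exists_true_left]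
      tauto
  · rw [Set.disjoint_left]
    rintro w ⟨-, hw⟩ ⟨⟨x, hx⟩, -, rfl⟩
    exact hx hw

/-- With high probability every one of the target sets `K t` of pairs of base degrees is hit. -/
theorem gprob_exists_forall_baseDeg_notMem_le {τ : Type*} [Fintype τ] (φ : ι × Bool ↪ V)
    (K : τ → Finset (ℕ × ℕ)) (ok : ℕ → Prop) (q Q : ℝ) {b : ℕ}
    (hb : Nat.card {v // v ∉ Set.range φ} = b) (hQ : ∀ t, Q ≤ q * (K t).card)
    (h : ∀ s s', ok s → ok s' → ∀ t, ∀ x ∈ K t, s ≤ x.1 ∧ s' ≤ x.2 ∧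
      q * (2 ^ b * 2 ^ b) ≤ (b.choose (x.1 - s) : ℝ) * b.choose (x.2 - s')) :
    gprob {G : SimpleGraph V |
        ∃ t, ∀ i, (baseDeg φ G (i, true), baseDeg φ G (i, false)) ∉ K t} ≤
      gprob {G : SimpleGraph V | ∃ p, ¬ ok (innerDeg φ G p)} +
        Fintype.card τ * Real.exp (-(Q * Fintype.card ι)) := by
  classical
  let β := {v // v ∉ Set.range φ}
  rw [Nat.card_eq_fintype_card] at hb
  change Fintype.card β = b at hb
  refine gprob_le_of_symmDiff (ι := ι → Finset β × Finset β)
    (fun f => spokeGraph φ fun p => Subtype.val '' (outerSpokes φ f p : Set β)) (by positivity) ?_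
  intro G hG
  have hok : ∀ p, ok (innerDeg φ G p) := by simpa using hG
  simp only [Set.mem_ofPred_eq, baseDeg_symmDiff_spokeGraph, outerSpokes, cond_true, cond_false]
  set N : ι × Bool → Finset β := fun p => Finset.univ.filter fun w : β => G.Adj (φ p) w with hN
  let E : τ → ι → Set (Finset β × Finset β) := fun t i =>
    {g | (innerDeg φ G (i, true) + (N (i, true) ∆ g.1).card,
      innerDeg φ G (i, false) + (N (i, false) ∆ g.2).card) ∈ K t}
  have hE : ∀ t i, Q * Nat.card (Finset β × Finset β) ≤ Nat.card (E t i) := by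
    intro t i
    have e1 : Nat.card (E t i) = ∑ x ∈ K t, b.choose (x.1 - innerDeg φ G (i, true)) *
        b.choose (x.2 - innerDeg φ G (i, false)) := by
      rw [Nat.card_eq_fintype_card, ← Set.toFinset_card,
        Finset.card_eq_sum_card_fiberwise (t := K t)
        (f := fun g : Finset β × Finset β => (innerDeg φ G (i, true) + (N (i, true) ∆ g.1).card,
          innerDeg φ G (i, false) + (N (i, false) ∆ g.2).card)) (by intro g; simp [E])]
      refine Finset.sum_congr rfl fun x hx => ?_
      obtain ⟨h1, h2, -⟩ := h _ _ (hok (i, true)) (hok (i, false)) t x hx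
      rw [← hb, ← card_filter_card_symmDiff_eq (N (i, true)) h1,
        ← card_filter_card_symmDiff_eq (N (i, false)) h2, ← Finset.card_product]
      congr 1
      ext ⟨g, g'⟩
      simp only [E, Finset.mem_filter, Set.mem_toFinset, Set.mem_ofPred_eq, Finset.mem_product,
        Finset.mem_univ, true_and, Prod.ext_iff, and_iff_right_iff_imp]
      rintro ⟨h1, h2⟩
      rw [h1, h2]
      exact hx
    have e2 : (Nat.card (Finset β × Finset β) : ℝ) = 2 ^ b * 2 ^ b := by
      rw [Nat.card_eq_fintype_card, Fintype.card_prod, Fintype.card_finset, hb]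
      push_cast
      rfl
    rw [e1, e2]
    push_cast
    calc _ ≤ (q * (K t).card) * (2 ^ b * 2 ^ b : ℝ) := by
          gcongr
          exact hQ t
      _ = ∑ x ∈ K t, q * (2 ^ b * 2 ^ b : ℝ) := by
          rw [Finset.sum_const, nsmul_eq_mul]
          ring
      _ ≤ _ := Finset.sum_le_sum fun x hx =>
          (h _ _ (hok (i, true)) (hok (i, false)) t x hx).2.2
  have hunion : {f : ι → Finset β × Finset β | ∃ t, ∀ i, f i ∉ E t i} =
      ⋃ t ∈ (Finset.univ : Finset τ), {f | ∀ i, f i ∉ E t i} := by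
    ext f
    simp
  calc _ = (({f : ι → Finset β × Finset β | ∃ t, ∀ i, f i ∉ E t i} : Set _).ncard : ℝ) := rfl
    _ ≤ ∑ t : τ, (({f : ι → Finset β × Finset β | ∀ i, f i ∉ E t i} : Set _).ncard : ℝ) := by
        rw [hunion]
        exact_mod_cast Finset.set_ncard_biUnion_le _ _
    _ ≤ ∑ t : τ, Real.exp (-(Q * Fintype.card ι)) * Nat.card (ι → Finset β × Finset β) :=
        Finset.sum_le_sum fun t _ => card_forall_notMem_le (E t) Q (hE t)
    _ = _ := by
        rw [Finset.sum_const, Finset.card_univ, nsmul_eq_mul, mul_assoc]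

end Randomization

section Concentration

theorem card_abs_sub_ge_le (M : Type*) [Fintype M] {t : ℝ} (ht : 0 ≤ t) :
    (Nat.card {g : Finset M // t ≤ |2 * (g.card : ℝ) - Fintype.card M|} : ℝ) ≤
      2 * Real.exp (-(t ^ 2 / (2 * Fintype.card M))) * 2 ^ Fintype.card M := by
  classical
  set n := Fintype.card M with hn
  set l : ℝ := t / n with hl
  have hsum : ∀ l : ℝ, ∑ g : Finset M, Real.exp (l * (2 * (g.card : ℝ) - n)) =
      (2 * Real.cosh l) ^ n := by
    intro l
    have := Finset.sum_pow_mul_eq_add_pow (Real.exp l) (Real.exp (-l)) (Finset.univ : Finset M)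
    rw [Finset.powerset_univ, Finset.card_univ, ← hn] at this
    rw [Real.cosh_eq, mul_div_cancel₀ _ two_ne_zero, ← this]
    refine Finset.sum_congr rfl fun g _ => ?_
    rw [← Real.exp_nat_mul, ← Real.exp_nat_mul, ← Real.exp_add,
      Nat.cast_sub (Finset.card_le_univ g)]
    congr 1
    ring
  have h1 : (Nat.card {g : Finset M // t ≤ |2 * (g.card : ℝ) - n|} : ℝ) * Real.exp (l * t) ≤
      2 * (2 * Real.cosh l) ^ n := by
    calc _ = ∑ g : Finset M with t ≤ |2 * (g.card : ℝ) - n|, Real.exp (l * t) := by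
          rw [Finset.sum_const, nsmul_eq_mul, Nat.card_eq_fintype_card, Fintype.card_subtype]
      _ ≤ ∑ g : Finset M with t ≤ |2 * (g.card : ℝ) - n|,
          (Real.exp (l * (2 * (g.card : ℝ) - n)) + Real.exp (-l * (2 * (g.card : ℝ) - n))) := by
          refine Finset.sum_le_sum fun g hg => ?_
          have hg' : t ≤ |2 * (g.card : ℝ) - n| := (Finset.mem_filter.1 hg).2
          have hl0 : 0 ≤ l := by positivity
          rcases le_abs.1 hg' with h | h
          · have : Real.exp (l * t) ≤ Real.exp (l * (2 * (g.card : ℝ) - n)) := by gcongr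
            linarith [Real.exp_pos (-l * (2 * (g.card : ℝ) - n))]
          · have : Real.exp (l * t) ≤ Real.exp (-l * (2 * (g.card : ℝ) - n)) := by
              rw [Real.exp_le_exp, neg_mul_comm]
              gcongr
            linarith [Real.exp_pos (l * (2 * (g.card : ℝ) - n))]
      _ ≤ ∑ g : Finset M,
          (Real.exp (l * (2 * (g.card : ℝ) - n)) + Real.exp (-l * (2 * (g.card : ℝ) - n))) :=
          Finset.sum_le_sum_of_subset_of_nonneg (Finset.filter_subset _ _)
            fun _ _ _ => by positivity
      _ = _ := by
          rw [Finset.sum_add_distrib, hsum, hsum, Real.cosh_neg]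
          ring
  have h2 : (2 * Real.cosh l) ^ n ≤ 2 ^ n * Real.exp (n * (l ^ 2 / 2)) := by
    rw [mul_pow, Real.exp_nat_mul]
    gcongr
    exact Real.cosh_le_exp_half_sq l
  have h3 : n * (l ^ 2 / 2) + -(l * t) = -(t ^ 2 / (2 * n)) := by
    rcases eq_or_ne (n : ℝ) 0 with h0 | h0
    · simp [hl, h0]
    · rw [hl]
      field_simp
      ring
  rw [← h3, Real.exp_add, Real.exp_neg (l * t)]
  rw [← le_div_iff₀ (Real.exp_pos _)] at h1
  refine h1.trans ?_
  rw [div_eq_mul_inv]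
  have := inv_pos.2 (Real.exp_pos (l * t))
  nlinarith [mul_le_mul_of_nonneg_right h2 this.le]

variable {V ι : Type*} [Finite V] [Fintype ι]

theorem gprob_abs_innerDeg_sub_ge_le (φ : ι × Bool ↪ V) (hm : 2 ≤ Fintype.card ι)
    (p : ι × Bool) {r : ℝ} (hr : 0 ≤ r) :
    gprob {G : SimpleGraph V | ¬ |(innerDeg φ G p : ℝ) - (Fintype.card ι - 1)| ≤ r} ≤
      2 * Real.exp (-(r ^ 2 / Fintype.card ι)) := by
  classical
  let M := {q : ι × Bool // q ≠ p ∧ q ≠ (p.1, !p.2)}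
  have hM : (Fintype.card M : ℝ) = 2 * (Fintype.card ι - 1) := by
    have h1 : Fintype.card M = ((Finset.univ.erase p).erase (p.1, !p.2)).card := by
      rw [Fintype.card_subtype]
      congr 1
      ext q
      simp [and_comm]
    rw [h1, Finset.card_erase_of_mem (by simp [(bool_pair_ne p).symm]),
      Finset.card_erase_of_mem (by simp), Finset.card_univ, Fintype.card_prod, Fintype.card_bool,
      Nat.sub_sub, Nat.cast_sub (by omega)]
    push_cast
    ring
  let t : Finset M → ι × Bool → Set V := fun g p' =>
    if p' = p then {w | ∃ q ∈ g, w = φ q.1} else ∅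
  have hadj : ∀ g w, (spokeGraph φ (t g)).Adj (φ p) w ↔ ∃ q ∈ g, w = φ q.1 := by
    intro g w
    rw [spokeGraph_adj]
    constructor
    · rintro ⟨hne, h | ⟨q, rfl, h⟩⟩
      · simpa [t] using h
      · by_cases hq : q = p
        · exact absurd (by rw [hq]) hne
        · simp [t, hq] at h
    · intro h
      refine ⟨?_, Or.inl (by simpa [t] using h)⟩
      rintro rfl
      obtain ⟨q, -, hq⟩ := h
      exact q.2.1 (φ.injective hq).symm
  have hdeg : ∀ G : SimpleGraph V, ∀ g, innerDeg φ (G ∆ spokeGraph φ (t g)) p =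
      ((Finset.univ.filter fun q : M => G.Adj (φ p) (φ q.1)) ∆ g).card := by
    intro G g
    rw [innerDeg, ← Set.ncard_coe_finset, ← Set.ncard_image_of_injective _
      (φ.injective.comp Subtype.val_injective)]
    congr 1
    ext w
    simp only [Set.mem_ofPred_eq, symmDiff_adj, hadj, Set.mem_image, Finset.mem_coe,
      Finset.mem_symmDiff, Finset.mem_filter, Finset.mem_univ, true_and, Function.comp_apply]
    constructor
    · rintro ⟨⟨h, hne⟩, ⟨q, rfl⟩⟩
      have hq2 : q ≠ (p.1, !p.2) := fun h => hne (by rw [h])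
      by_cases hq1 : q = p
      · subst hq1
        have : ¬ G.Adj (φ q) (φ q) := G.irrefl
        have h' : ¬ ¬ ∃ q' ∈ g, φ q = φ q'.1 := fun hh => this (h.2 hh)
        obtain ⟨q', -, hq'⟩ := not_not.1 h'
        exact absurd (φ.injective hq').symm q'.2.1
      · refine ⟨⟨q, hq1, hq2⟩, ?_, rfl⟩
        have : (∃ q' ∈ g, φ q = φ q'.1) ↔ (⟨q, hq1, hq2⟩ : M) ∈ g := by
          constructor
          · rintro ⟨q', hq', e⟩
            have : (⟨q, hq1, hq2⟩ : M) = q' := Subtype.ext (φ.injective e)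
            rwa [this]
          · intro h
            exact ⟨_, h, rfl⟩
        rw [this] at h
        tauto
    · rintro ⟨q, h, rfl⟩
      refine ⟨⟨?_, fun e => q.2.2 (φ.injective e)⟩, ⟨q.1, rfl⟩⟩
      have : (∃ q' ∈ g, φ q.1 = φ q'.1) ↔ q ∈ g := by
        constructor
        · rintro ⟨q', hq', e⟩
          have : q = q' := Subtype.ext (φ.injective e)
          rwa [this]
        · intro h
          exact ⟨_, h, rfl⟩
      rw [this]
      tauto
  have h0 : gprob (∅ : Set (SimpleGraph V)) = 0 := by simp [gprob]
  rw [← zero_add (2 * Real.exp _), ← h0]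
  refine gprob_le_of_symmDiff (fun g => spokeGraph φ (t g)) (by positivity) fun G _ => ?_
  set N := Finset.univ.filter fun q : M => G.Adj (φ p) (φ q.1) with hN
  have hcard : Nat.card {g // G ∆ spokeGraph φ (t g) ∈
      {G : SimpleGraph V | ¬ |(innerDeg φ G p : ℝ) - (Fintype.card ι - 1)| ≤ r}} ≤
      Nat.card {g : Finset M // 2 * r ≤ |2 * (g.card : ℝ) - Fintype.card M|} := by
    refine Nat.card_le_card_of_injective (fun g => ⟨N ∆ g.1, ?_⟩) ?_
    · have := g.2
      rw [Set.mem_ofPred_eq, hdeg, not_le] at this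
      rw [hM, ← mul_sub, abs_mul, abs_two]
      linarith
    · intro g g' h
      exact Subtype.ext (symmDiff_right_injective N (congrArg Subtype.val h))
  refine (Nat.cast_le.2 hcard).trans ((card_abs_sub_ge_le M (by linarith)).trans ?_)
  rw [Nat.card_eq_fintype_card, Fintype.card_finset]
  push_cast
  gcongr ?_ * ?_
  gcongr 2 * ?_
  rw [Real.exp_le_exp, neg_le_neg_iff, hM]
  have hm' : (2 : ℝ) ≤ Fintype.card ι := by exact_mod_cast hm
  rw [div_le_div_iff₀ (by linarith) (by linarith)]
  nlinarith [sq_nonneg r]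

theorem gprob_exists_abs_innerDeg_sub_ge_le (φ : ι × Bool ↪ V) (hm : 2 ≤ Fintype.card ι)
    {r : ℝ} (hr : 0 ≤ r) :
    gprob {G : SimpleGraph V | ∃ p, ¬ |(innerDeg φ G p : ℝ) - (Fintype.card ι - 1)| ≤ r} ≤
      4 * Fintype.card ι * Real.exp (-(r ^ 2 / Fintype.card ι)) := by
  classical
  have : ∀ s : Finset (ι × Bool),
      gprob {G : SimpleGraph V | ∃ p ∈ s, ¬ |(innerDeg φ G p : ℝ) - (Fintype.card ι - 1)| ≤ r} ≤
      s.card * (2 * Real.exp (-(r ^ 2 / Fintype.card ι))) := by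
    intro s
    induction s using Finset.induction_on with
    | empty => simp [gprob]
    | insert p s hp ih =>
      have e : {G : SimpleGraph V | ∃ p' ∈ insert p s,
          ¬ |(innerDeg φ G p' : ℝ) - (Fintype.card ι - 1)| ≤ r} =
          {G : SimpleGraph V | ¬ |(innerDeg φ G p : ℝ) - (Fintype.card ι - 1)| ≤ r} ∪
          {G | ∃ p ∈ s, ¬ |(innerDeg φ G p : ℝ) - (Fintype.card ι - 1)| ≤ r} := by
        ext G
        simp
      rw [e, Finset.card_insert_of_notMem hp]
      refine (gprob_union_le _ _).trans ?_
      have := gprob_abs_innerDeg_sub_ge_le φ hm p hr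
      push_cast
      linarith
  have h := this Finset.univ
  rw [Finset.card_univ, Fintype.card_prod, Fintype.card_bool] at h
  simp only [Finset.mem_univ, true_and] at h
  refine h.trans (le_of_eq ?_)
  push_cast
  ring

end Concentration

section Binomial

theorem sixteen_pow_le_mul_centralBinom_sq {h : ℕ} (hh : 1 ≤ h) :
    16 ^ h ≤ 4 * h * h.centralBinom ^ 2 := by
  induction h, hh using Nat.le_induction with
  | base => decide
  | succ n hn ih =>
    have key := Nat.succ_mul_centralBinom_succ n
    have h1 : (n + 1) * 16 ^ (n + 1) ≤ (n + 1) * (4 * (n + 1) * (n + 1).centralBinom ^ 2) := by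
      calc (n + 1) * 16 ^ (n + 1) = 16 * (n + 1) * 16 ^ n := by ring
        _ ≤ 16 * (n + 1) * (4 * n * n.centralBinom ^ 2) := by gcongr
        _ = (16 * (4 * n * (n + 1))) * n.centralBinom ^ 2 := by ring
        _ ≤ (16 * (2 * n + 1) ^ 2) * n.centralBinom ^ 2 := by
            gcongr
            nlinarith
        _ = 4 * (2 * (2 * n + 1) * n.centralBinom) ^ 2 := by ring
        _ = _ := by
            rw [← key]
            ring
    exact Nat.le_of_mul_le_mul_left h1 (by omega)

theorem four_pow_div_le_centralBinom {h : ℕ} (hh : 1 ≤ h) :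
    (4 : ℝ) ^ h / (2 * √h) ≤ h.centralBinom := by
  have h1 : ((16 : ℝ)) ^ h ≤ 4 * h * h.centralBinom ^ 2 := by
    exact_mod_cast sixteen_pow_le_mul_centralBinom_sq hh
  have hpos : (0 : ℝ) < h := by exact_mod_cast hh
  rw [div_le_iff₀ (by positivity)]
  refine le_of_sq_le_sq ?_ (by positivity)
  rw [← pow_mul, mul_comm h 2, pow_mul, mul_pow, mul_pow, Real.sq_sqrt hpos.le]
  norm_num
  linarith

theorem centralBinom_mul_exp_le_choose {h j : ℕ} {Y : ℝ} (hj : (j : ℝ) ≤ Y) (hY : Y < h) :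
    h.centralBinom * Real.exp (-(j ^ 2 / (h - Y))) ≤ (2 * h).choose (h + j) := by
  induction j with
  | zero => simp [Nat.centralBinom_eq_two_mul_choose]
  | succ j ih =>
    have hj' : (j : ℝ) + 1 ≤ Y := by exact_mod_cast hj
    have ih := ih (by linarith)
    have hlt : j < h := by
      have : (j : ℝ) < h := by linarith
      exact_mod_cast this
    have hd : 0 < (h : ℝ) - Y := by linarith
    have e : ((2 * h).choose (h + (j + 1)) : ℝ) * (h + j + 1) =
        (2 * h).choose (h + j) * (h - j) := by
      have := Nat.choose_succ_right_eq (2 * h) (h + j)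
      have h2 : 2 * h - (h + j) = h - j := by omega
      rw [h2] at this
      have h3 : (((2 * h).choose (h + j + 1) * (h + j + 1) : ℕ) : ℝ) =
        ((2 * h).choose (h + j) * (h - j) : ℕ) := by exact_mod_cast this
      push_cast [Nat.cast_sub hlt.le] at h3
      exact h3
    have hpos : (0 : ℝ) < h + j + 1 := by positivity
    have hx : Real.exp (-((2 * j + 1) / (h - Y))) * (h + j + 1) ≤ h - j := by
      have h1 := Real.add_one_le_exp ((2 * j + 1) / ((h : ℝ) - Y))
      rw [Real.exp_neg, inv_mul_le_iff₀ (Real.exp_pos _)]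
      have h2 : (h : ℝ) - j ≥ h - Y := by linarith
      have h3 : (2 * j + 1) / ((h : ℝ) - Y) * (h - Y) = 2 * j + 1 := by field_simp
      have h4 : 0 ≤ (2 * j + 1) / ((h : ℝ) - Y) := by positivity
      nlinarith
    have hs : Real.exp (-(((j + 1 : ℕ) : ℝ) ^ 2 / (h - Y))) =
        Real.exp (-(j ^ 2 / (h - Y))) * Real.exp (-((2 * j + 1) / (h - Y))) := by
      rw [← Real.exp_add]
      congr 1
      push_cast
      ring
    refine le_of_mul_le_mul_right ?_ hpos
    rw [e, hs, ← mul_assoc, mul_assoc _ _ ((h : ℝ) + j + 1)]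
    exact mul_le_mul ih hx (by positivity) (by positivity)

/-- A local lower bound for the symmetric binomial distribution. -/
theorem exp_div_mul_two_pow_le_choose {N h k : ℕ} (hN : N / 2 = h) {Y : ℝ} (hh : 1 ≤ h)
    (hk : |(k : ℝ) - h| ≤ Y) (hY : Y < h) :
    Real.exp (-(Y ^ 2 / (h - Y))) / (4 * √h) * 2 ^ N ≤ N.choose k := by
  have hd : 0 < (h : ℝ) - Y := by linarith
  have hY0 : 0 ≤ Y := (abs_nonneg _).trans hk
  obtain ⟨j, hj, hc⟩ : ∃ j : ℕ, (j : ℝ) ≤ Y ∧ (2 * h).choose k = (2 * h).choose (h + j) := by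
    rcases le_total h k with hle | hle
    · refine ⟨k - h, ?_, by rw [Nat.add_sub_cancel' hle]⟩
      rw [Nat.cast_sub hle]
      exact (le_abs_self _).trans hk
    · refine ⟨h - k, ?_, ?_⟩
      · rw [Nat.cast_sub hle]
        rw [abs_sub_comm] at hk
        exact (le_abs_self _).trans hk
      · rw [← Nat.choose_symm (by omega)]
        congr 1
        omega
  have h1 := centralBinom_mul_exp_le_choose hj hY
  have h2 := four_pow_div_le_centralBinom hh
  have h3 : Real.exp (-(Y ^ 2 / (h - Y))) ≤ Real.exp (-(j ^ 2 / (h - Y))) := by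
    gcongr
  have h4 : (2 : ℝ) ^ N ≤ 2 * 4 ^ h := by
    have : (2 : ℝ) * 4 ^ h = 2 ^ (2 * h + 1) := by
      rw [pow_succ, pow_mul]
      norm_num
      ring
    rw [this]
    exact pow_le_pow_right₀ (by norm_num) (by omega)
  have hpos : (0 : ℝ) < √h := by
    have : (0 : ℝ) < h := by exact_mod_cast hh
    positivity
  calc _ ≤ Real.exp (-(j ^ 2 / (h - Y))) / (4 * √h) * (2 * 4 ^ h) := by gcongr
    _ = (4 ^ h / (2 * √h)) * Real.exp (-(j ^ 2 / (h - Y))) := by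
        field_simp
        ring
    _ ≤ h.centralBinom * Real.exp (-(j ^ 2 / (h - Y))) := by gcongr
    _ ≤ (2 * h).choose (h + j) := h1
    _ ≤ N.choose k := by
        rw [← hc]
        exact_mod_cast Nat.choose_le_choose k (by omega)

end Binomial

section DegreeStatistics

theorem natCast_ncard_eq_sum {V M : Type*} [Fintype V] [AddCommMonoidWithOne M] (p : V → Prop)
    [DecidablePred p] : (Set.ncard {v | p v} : M) = ∑ v, if p v then 1 else 0 := by
  rw [Finset.sum_boole, ← Set.ncard_coe_finset]
  simp

/-- The indicator functions of degrees whose sums over the vertices are the entries of `Y↓` and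
`Y↑`. -/
noncomputable def parityIndicator (n : ℕ) : Fin (delta1 n) ⊕ Fin (delta2 n) → ℕ → ZMod 2
  | .inl j, d => if dstar n ≤ d ∧ (d : ℤ) ≤ dstar n + (j : ℕ) then 1 else 0
  | .inr j, d => if dstar n ≤ d ∧ (d : ℤ) ≤ ((n / 2 : ℕ) : ℤ) + 1 + (j : ℕ) then 1 else 0

theorem Ydown_eq {n : ℕ} (G : SimpleGraph (Fin n)) :
    Ydown G = fun j => ∑ v, parityIndicator n (.inl j) (ndeg G v) := by
  funext j
  rw [Ydown, Xcount, natCast_ncard_eq_sum]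
  rfl

theorem Yup_eq {n : ℕ} (G : SimpleGraph (Fin n)) :
    Yup G = fun j => ∑ v, parityIndicator n (.inr j) (ndeg G v) := by
  funext j
  rw [Yup, Xcount, natCast_ncard_eq_sum]
  rfl

/-- The function of degrees whose sum over the vertices is `Z`. -/
noncomputable def lowerDegree (n : ℕ) (d : ℕ) : ℤ :=
  if dstar n ≤ d ∧ (d : ℤ) ≤ ((n / 2 : ℕ) : ℤ) then (d : ℤ) else 0

theorem Zsum_eq {n : ℕ} (G : SimpleGraph (Fin n)) :
    Zsum G = ∑ v, lowerDegree n (ndeg G v) := by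
  simp only [Zsum, Ncount, natCast_ncard_eq_sum, Finset.mul_sum]
  rw [Finset.sum_comm]
  refine Finset.sum_congr rfl fun v _ => ?_
  simp [lowerDegree]

/-- The words whose two components lie in the two given codes. -/
def sumCode {α β : Type*} (S : Set (α → ZMod 2)) (T : Set (β → ZMod 2)) : Set (α ⊕ β → ZMod 2) :=
  {y | (fun j => y (.inl j)) ∈ S ∧ (fun j => y (.inr j)) ∈ T}

theorem card_sumCode {α β : Type*} (S : Set (α → ZMod 2)) (T : Set (β → ZMod 2)) :
    Nat.card (sumCode S T) = Nat.card S * Nat.card T := by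
  rw [← Nat.card_prod]
  refine Nat.card_congr (((Equiv.sumArrowEquivProdArrow α β (ZMod 2)).subtypeEquiv
    (q := fun x => x ∈ S ×ˢ T) fun y => Iff.rfl).trans (Equiv.Set.prod S T))

/-- The target pairs of base degrees: they connect each parity coordinate to a degree just below
`c`, connect the latter to degrees above `hi`, and provide equal pairs below `c`. -/
def targetPairs (lo hi c r : ℕ) :
    {d // d ∈ Finset.Icc lo hi} ⊕ {f // f ∈ Finset.Ico (c - r) c} ⊕ Unit → Finset (ℕ × ℕ)
  | .inl d => {d.1} ×ˢ Finset.Ico (c - r) c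
  | .inr (.inl f) => {f.1} ×ˢ Finset.Ioc hi (hi + r)
  | .inr (.inr _) => (Finset.Ico (c - r) c).image fun x => (x, x)

theorem card_targetPairs {lo hi c r : ℕ} (h : r ≤ c)
    (t : {d // d ∈ Finset.Icc lo hi} ⊕ {f // f ∈ Finset.Ico (c - r) c} ⊕ Unit) :
    (targetPairs lo hi c r t).card = r := by
  rcases t with d | f | _
  · simp [targetPairs, Nat.sub_sub_self h]
  · simp [targetPairs]
  · rw [targetPairs, Finset.card_image_of_injective _ (fun x y h => (Prod.ext_iff.1 h).1)]
    simp [Nat.sub_sub_self h]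

theorem exists_parityIndicator_sum_eq_single {ι : Type*} {n lo hi r : ℕ} (hlo : dstar n = lo)
    (hhi : dtop n = hi) (hlc : lo ≤ n / 2) (hch : n / 2 ≤ hi) {a : ι × Bool → ℕ}
    (ha : ∀ t, ∃ i, (a (i, true), a (i, false)) ∈ targetPairs lo hi (n / 2) r t)
    (j : Fin (delta1 n) ⊕ Fin (delta2 n)) : ∃ i i', ∀ j',
      ((parityIndicator n j' (a (i, true)) + parityIndicator n j' (a (i, true) + 1)) +
        (parityIndicator n j' (a (i, false)) + parityIndicator n j' (a (i, false) + 1))) +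
      ((parityIndicator n j' (a (i', true)) + parityIndicator n j' (a (i', true) + 1)) +
        (parityIndicator n j' (a (i', false)) + parityIndicator n j' (a (i', false) + 1))) =
      (Pi.single j 1 : Fin (delta1 n) ⊕ Fin (delta2 n) → ZMod 2) j' := by
  have hd1 : delta1 n = n / 2 - lo := by
    rw [delta1, hlo]
    omega
  have hd2 : delta2 n = hi - n / 2 := by
    rw [delta2, hhi]
    omega
  let y : Fin (delta1 n) ⊕ Fin (delta2 n) → ℕ := Sum.elim (fun j => lo + j) (fun j => n / 2 + 1 + j)
  have hpar : ∀ j d, parityIndicator n j d = if lo ≤ d ∧ d ≤ y j then 1 else 0 := by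
    rintro (j | j) d
    · simp only [parityIndicator, hlo, y, Sum.elim_inl]
      congr 1
      norm_cast
    · simp only [parityIndicator, hlo, y, Sum.elim_inr]
      congr 1
      norm_cast
  have hylo : ∀ j, lo ≤ y j := by
    rintro (j | j) <;> simp only [y, Sum.elim_inl, Sum.elim_inr] <;> omega
  have hyhi : ∀ j, y j ≤ hi := by
    rintro (j | j) <;> simp only [y, Sum.elim_inl, Sum.elim_inr] <;> have := j.2 <;> omega
  have hyinj : Function.Injective y := by
    rintro (j | j) (j' | j') h <;> simp only [y, Sum.elim_inl, Sum.elim_inr] at h <;>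
      have := j.2 <;> have := j'.2
    · rw [Sum.inl.injEq, Fin.ext_iff]
      omega
    · omega
    · omega
    · rw [Sum.inr.injEq, Fin.ext_iff]
      omega
  obtain ⟨i, hi1⟩ := ha (.inl ⟨y j, Finset.mem_Icc.2 ⟨hylo j, hyhi j⟩⟩)
  simp only [targetPairs, Finset.mem_product, Finset.mem_singleton] at hi1
  obtain ⟨i', hi2⟩ := ha (.inr (.inl ⟨a (i, false), hi1.2⟩))
  simp only [targetPairs, Finset.mem_product, Finset.mem_singleton, Finset.mem_Ioc] at hi2
  refine ⟨i, i', fun j' => ?_⟩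
  rw [hi1.1, hi2.1]
  generalize a (i, false) = f
  have hout : ∀ d, hi < d → parityIndicator n j' d = 0 := by
    intro d hd
    rw [hpar, if_neg]
    have := hyhi j'
    omega
  rw [hout _ hi2.2.1, hout (a (i', false) + 1) (by omega), add_zero, add_zero, add_assoc,
    CharTwo.add_self_eq_zero, add_zero, hpar, hpar, Pi.single_apply]
  have hlo' := hylo j
  by_cases h : j' = j
  · subst h
    rw [if_pos ⟨hlo', le_rfl⟩, if_neg (by omega), if_pos rfl, add_zero]
  · rw [if_neg h]
    have hne : y j' ≠ y j := fun e => h (hyinj e)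
    by_cases hle : y j ≤ y j'
    · rw [if_pos ⟨hlo', hle⟩, if_pos (by omega)]
      exact CharTwo.add_self_eq_zero 1
    · rw [if_neg (by omega), if_neg (by omega), add_zero]

/-- The first `2 m` vertices of `Fin n`, arranged in pairs. -/
def pairEmbedding {n m : ℕ} (h : m * 2 ≤ n) : Fin m × Bool ↪ Fin n :=
  ((Equiv.prodCongr (Equiv.refl _) finTwoEquiv.symm).trans finProdFinEquiv).toEmbedding.trans
    (Fin.castLEEmb h)

theorem card_notMem_range_pairEmbedding {n m : ℕ} (h : m * 2 ≤ n) :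
    Nat.card {v // v ∉ Set.range (pairEmbedding h)} = n - 2 * m := by
  have h1 : (Set.range (pairEmbedding h)).ncard = 2 * m := by
    rw [← Set.image_univ, Set.ncard_image_of_injective _ (pairEmbedding h).injective,
      Set.ncard_univ, Nat.card_prod]
    simp [mul_comm]
  have h2 := Set.ncard_add_ncard_compl (Set.range (pairEmbedding h))
  rw [Nat.card_fin, h1] at h2
  change (Set.range (pairEmbedding h))ᶜ.ncard = _
  omega

theorem abs_gprob_sub_le {n m lo hi r : ℕ} (hlo : dstar n = lo) (hhi : dtop n = hi)
    (hlc : lo + r ≤ n / 2) (hch : n / 2 ≤ hi) (hin : hi ≤ n) (hm : 2 ≤ m) (hmn : m * 2 ≤ n)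
    {p₁ p₂ : ℝ} (hp₁ : 0 ≤ p₁) (hp₂ : 0 ≤ p₂)
    (H₁ : ∀ s k : ℕ, |(s : ℝ) - (m - 1)| ≤ r → lo ≤ k → k ≤ hi + r →
      s ≤ k ∧ p₁ * 2 ^ (n - 2 * m) ≤ (n - 2 * m).choose (k - s))
    (H₂ : ∀ s k : ℕ, |(s : ℝ) - (m - 1)| ≤ r → n / 2 - r ≤ k → k < n / 2 →
      p₂ * 2 ^ (n - 2 * m) ≤ (n - 2 * m).choose (k - s))
    (Sd : Set (Fin (delta1 n) → ZMod 2)) (Su : Set (Fin (delta2 n) → ZMod 2)) :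
    |gprob {G : SimpleGraph (Fin n) |
        Ydown G ∈ Sd ∧ Yup G ∈ Su ∧ (Zsum G % 4 = 0 ∨ Zsum G % 4 = 1)} -
      (Nat.card Sd / 2 ^ delta1 n) * (Nat.card Su / 2 ^ delta2 n) / 2| ≤
      4 * m * Real.exp (-((r : ℝ) ^ 2 / m)) + 3 * (n + 1) * Real.exp (-(p₁ * p₂ * r * m)) := by
  classical
  set φ := pairEmbedding hmn
  set A := {G : SimpleGraph (Fin n) |
        Ydown G ∈ Sd ∧ Yup G ∈ Su ∧ (Zsum G % 4 = 0 ∨ Zsum G % 4 = 1)} with hA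
  let P : (Fin m × Bool → ℕ) → Prop := fun a =>
    ∀ t, ∃ i, (a (i, true), a (i, false)) ∈ targetPairs lo hi (n / 2) r t
  set W := {G : SimpleGraph (Fin n) | P (baseDeg φ G)} with hW
  have hbad : gprob Wᶜ ≤
      4 * m * Real.exp (-((r : ℝ) ^ 2 / m)) + 3 * (n + 1) * Real.exp (-(p₁ * p₂ * r * m)) := by
    have h1 := gprob_exists_forall_baseDeg_notMem_le φ (targetPairs lo hi (n / 2) r)
      (fun s => |(s : ℝ) - ((Fintype.card (Fin m) : ℝ) - 1)| ≤ r) (p₁ * p₂) (p₁ * p₂ * r)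
      (card_notMem_range_pairEmbedding hmn)
      (fun t => by rw [card_targetPairs (by omega)]) (by
        intro s s' hs hs' t x hx
        rw [Fintype.card_fin] at hs hs'
        have comb : ∀ u v : ℝ, p₁ * 2 ^ (n - 2 * m) ≤ u → p₂ * 2 ^ (n - 2 * m) ≤ v →
            p₁ * p₂ * (2 ^ (n - 2 * m) * 2 ^ (n - 2 * m)) ≤ u * v := by
          intro u v hu hv
          have h0 : 0 ≤ p₁ * (2 : ℝ) ^ (n - 2 * m) := by positivity
          calc _ = (p₁ * 2 ^ (n - 2 * m)) * (p₂ * 2 ^ (n - 2 * m)) := by ring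
            _ ≤ _ := mul_le_mul hu hv (by positivity) (h0.trans hu)
        rcases t with d | f | _
        · simp only [targetPairs, Finset.mem_product, Finset.mem_singleton, Finset.mem_Ico] at hx
          have hd := Finset.mem_Icc.1 d.2
          have a1 := H₁ s x.1 hs (by omega) (by omega)
          have a2 := H₁ s' x.2 hs' (by omega) (by omega)
          have a3 := H₂ s' x.2 hs' (by omega) (by omega)
          exact ⟨a1.1, a2.1, comb _ _ a1.2 a3⟩
        · simp only [targetPairs, Finset.mem_product, Finset.mem_singleton, Finset.mem_Ioc] at hx
          have hf := Finset.mem_Ico.1 f.2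
          have a1 := H₁ s' x.2 hs' (by omega) (by omega)
          have a2 := H₁ s x.1 hs (by omega) (by omega)
          have a3 := H₂ s x.1 hs (by omega) (by omega)
          refine ⟨a2.1, a1.1, ?_⟩
          rw [mul_comm ((n - 2 * m).choose (x.1 - s) : ℝ)]
          exact comb _ _ a1.2 a3
        · simp only [targetPairs, Finset.mem_image, Finset.mem_Ico] at hx
          obtain ⟨k, hk, rfl⟩ := hx
          have a1 := H₁ s k hs (by omega) (by omega)
          have a2 := H₁ s' k hs' (by omega) (by omega)
          have a3 := H₂ s' k hs' (by omega) (by omega)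
          exact ⟨a1.1, a2.1, comb _ _ a1.2 a3⟩)
    have h2 := gprob_exists_abs_innerDeg_sub_ge_le φ (by simpa using hm)
      (Nat.cast_nonneg (α := ℝ) r)
    have h3 : Wᶜ = {G : SimpleGraph (Fin n) | ∃ t, ∀ i, (baseDeg φ G (i, true),
        baseDeg φ G (i, false)) ∉ targetPairs lo hi (n / 2) r t} := by
      ext G
      simp only [hW, P, Set.mem_compl_iff, Set.mem_ofPred_eq, not_forall, not_exists]
    rw [h3]
    refine h1.trans (add_le_add (h2.trans (by rw [Fintype.card_fin])) ?_)
    rw [Fintype.card_fin]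
    gcongr
    rw [Fintype.card_sum, Fintype.card_sum, Fintype.card_coe, Fintype.card_coe, Nat.card_Icc,
      Nat.card_Ico, Fintype.card_unit]
    have : hi + 1 - lo + (n / 2 - (n / 2 - r) + 1) ≤ 3 * (n + 1) := by omega
    exact_mod_cast this
  set S := sumCode Sd Su with hS
  have hAeq : W ∩ A = {G : SimpleGraph (Fin n) | (P (baseDeg φ G) ∧
      (fun j => ∑ v, parityIndicator n j (ndeg G v)) ∈ S) ∧
      ((∑ v, lowerDegree n (ndeg G v)) % 4 = 0 ∨ (∑ v, lowerDegree n (ndeg G v)) % 4 = 1)} := by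
    ext G
    simp only [hW, hA, Set.mem_inter_iff, Set.mem_ofPred_eq, Ydown_eq, Yup_eq, Zsum_eq, hS, sumCode]
    tauto
  have e1 := two_mul_gprob_parity_mem_and_mod_four φ (parityIndicator n) (lowerDegree n) P (by
    intro a ha
    obtain ⟨i, hi1⟩ := ha (.inr (.inr ()))
    simp only [targetPairs, Finset.mem_image, Finset.mem_Ico, Prod.ext_iff] at hi1
    obtain ⟨k, hk, h1, h2⟩ := hi1
    refine ⟨i, h1.symm.trans h2, ?_⟩
    rw [← h2, lowerDegree, lowerDegree, hlo, if_pos (by omega), if_pos (by omega)]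
    push_cast
    rfl) S
  have e2 := gprob_parity_mem φ (parityIndicator n) P
    (fun a ha => exists_parityIndicator_sum_eq_single hlo hhi (by omega) hch ha) S
  rw [e2, ← hAeq, ← hW, card_sumCode, Fintype.card_sum, Fintype.card_fin, Fintype.card_fin] at e1
  have e3 := gprob_add_compl W
  have e4 : gprob (W ∩ A) ≤ gprob A := gprob_mono Set.inter_subset_right
  have e5 : gprob A ≤ gprob (W ∩ A) + gprob Wᶜ := by
    refine (gprob_mono (B := (W ∩ A) ∪ Wᶜ) ?_).trans (gprob_union_le _ _)
    intro G hG
    by_cases hGW : G ∈ W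
    · exact Or.inl ⟨hGW, hG⟩
    · exact Or.inr hGW
  set ρ : ℝ := (Nat.card Sd / 2 ^ delta1 n) * (Nat.card Su / 2 ^ delta2 n) with hρ
  have e6 : ((Nat.card Sd * Nat.card Su : ℕ) : ℝ) / 2 ^ (delta1 n + delta2 n) = ρ := by
    rw [hρ, pow_add]
    push_cast
    rw [div_mul_div_comm]
  rw [e6] at e1
  have hle : ∀ (k : ℕ) (T : Set (Fin k → ZMod 2)), (Nat.card T : ℝ) / 2 ^ k ≤ 1 := by
    intro k T
    rw [div_le_one (by positivity)]
    have h1 : Nat.card T ≤ Nat.card (Fin k → ZMod 2) := Finite.card_subtype_le _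
    rw [Nat.card_eq_fintype_card (α := Fin k → ZMod 2), Fintype.card_fun, ZMod.card,
      Fintype.card_fin] at h1
    exact_mod_cast h1
  have hρ0 : 0 ≤ ρ := by positivity
  have hρ1 : ρ ≤ 1 := mul_le_one₀ (hle _ _) (by positivity) (hle _ _)
  have e7 := gprob_nonneg Wᶜ
  rw [abs_le]
  constructor <;> nlinarith

end DegreeStatistics

section Asymptotics

/-- Numerical data for a large number `n` of vertices: `t = √(log n)` and `q = √n`, with `q` and
`exp (t / 2)` dominating the relevant powers of `t`. -/
structure IsLarge (n : ℕ) (t q : ℝ) : Prop where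
  sqrt_log : √(Real.log n) = t
  sq_eq : q ^ 2 = n
  exp_eq : Real.exp (t ^ 2 / 2) = q
  le_t : 300 ≤ t
  pow_le : t ^ 8 ≤ q
  le_exp : 30720 * t ^ 6 ≤ Real.exp (t / 2)

namespace IsLarge

variable {n : ℕ} {t q : ℝ}

theorem log_eq (H : IsLarge n t q) : Real.log n = t ^ 2 := by
  rw [← H.sq_eq, ← H.exp_eq, ← Real.exp_nat_mul, Real.log_exp]
  push_cast; ring

theorem t_pos (H : IsLarge n t q) : 0 < t := by linarith [H.le_t]

theorem q_pos (H : IsLarge n t q) : 0 < q := H.exp_eq ▸ Real.exp_pos _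

theorem pow_mul_le (H : IsLarge n t q) : 300 * t ^ 7 ≤ q := by
  have := H.pow_le
  have h1 := H.le_t
  have h2 : 0 ≤ t ^ 7 := by have := H.t_pos; positivity
  nlinarith

theorem mul_le (H : IsLarge n t q) : 10 ^ 6 * t ≤ q := by
  have h1 := H.le_t
  have h2 : (300 : ℝ) ^ 6 ≤ t ^ 6 := by gcongr
  have := H.pow_mul_le
  nlinarith [H.t_pos]

theorem bnd_eq (H : IsLarge n t q) : bnd n = 1 / 2 * (q * √(t ^ 2 - 2 * t)) := by
  have := H.q_pos
  rw [bnd, H.sqrt_log, H.log_eq, ← H.sq_eq, Real.sqrt_mul (by positivity),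
    Real.sqrt_sq this.le]

theorem bnd_sq (H : IsLarge n t q) : bnd n ^ 2 = q ^ 2 * (t ^ 2 - 2 * t) / 4 := by
  have := H.le_t
  rw [H.bnd_eq, mul_pow, mul_pow, Real.sq_sqrt (by nlinarith)]
  ring

theorem bnd_nonneg (n : ℕ) : 0 ≤ bnd n := by unfold bnd; positivity

theorem bnd_le (H : IsLarge n t q) : bnd n ≤ q * t / 2 := by
  have := H.t_pos
  have := H.q_pos
  refine abs_le_of_sq_le_sq' ?_ (by positivity) |>.2
  rw [H.bnd_sq]
  have : 0 ≤ q ^ 2 * t := by positivity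
  nlinarith

theorem le_bnd (H : IsLarge n t q) : q ≤ bnd n := by
  refine abs_le_of_sq_le_sq' ?_ (bnd_nonneg n) |>.2
  rw [H.bnd_sq]
  have h1 := H.le_t
  have h2 : 4 ≤ t ^ 2 - 2 * t := by nlinarith
  nlinarith [sq_nonneg q]

theorem exists_endpoints (H : IsLarge n t q) : ∃ lo hi : ℕ, dstar n = lo ∧ dtop n = hi ∧
    (n : ℝ) / 2 - bnd n ≤ lo ∧ (lo : ℝ) ≤ n / 2 - bnd n + 1 ∧
    (hi : ℝ) ≤ n / 2 + bnd n ∧ n / 2 + bnd n - 1 ≤ hi := by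
  have h1 := H.bnd_le
  have h2 := H.mul_le
  have h3 := H.q_pos
  have h4 := H.sq_eq
  have h5 := bnd_nonneg n
  have h6 := H.t_pos
  have h7 : 0 ≤ (n : ℝ) / 2 - bnd n := by nlinarith
  have h8 : 0 ≤ (n : ℝ) / 2 + bnd n := by positivity
  obtain ⟨lo, hlo⟩ := Int.eq_ofNat_of_zero_le (a := dstar n) (Int.ceil_nonneg h7)
  obtain ⟨hi, hhi⟩ := Int.eq_ofNat_of_zero_le (a := dtop n) (Int.floor_nonneg.2 h8)
  have e1 : ((dstar n : ℤ) : ℝ) = lo := by rw [hlo]; simp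
  have e2 : ((dtop n : ℤ) : ℝ) = hi := by rw [hhi]; simp
  refine ⟨lo, hi, hlo, hhi, ?_, ?_, ?_, ?_⟩
  · rw [← e1]; exact Int.le_ceil _
  · rw [← e1]; exact (Int.ceil_lt_add_one _).le
  · rw [← e2]; exact Int.floor_le _
  · rw [← e2]
    linarith [Int.lt_floor_add_one ((n : ℝ) / 2 + bnd n),
      show (dtop n : ℝ) = ⌊(n : ℝ) / 2 + bnd n⌋ from rfl]

theorem half_bounds (n : ℕ) :
    (n : ℝ) / 2 - 1 / 2 ≤ (n / 2 : ℕ) ∧ ((n / 2 : ℕ) : ℝ) ≤ n / 2 := by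
  have h1 : n ≤ 2 * (n / 2) + 1 := by omega
  have h2 : 2 * (n / 2) ≤ n := by omega
  have h1' : (n : ℝ) ≤ 2 * (n / 2 : ℕ) + 1 := by exact_mod_cast h1
  have h2' : 2 * ((n / 2 : ℕ) : ℝ) ≤ n := by exact_mod_cast h2
  constructor <;> linarith

/-- Binomial coefficients of `n - 2 * m` near the centre, with the displacement measured by `Y`. -/
theorem exp_div_mul_two_pow_le_choose_sub (H : IsLarge n t q) {m k s : ℕ} {Y : ℝ}
    (hm : (m : ℝ) * t ^ 4 ≤ q ^ 2) (hsk : s ≤ k)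
    (hY : |(k : ℝ) - (n / 2 : ℕ)| + |(s : ℝ) - (m - 1)| + 1 ≤ Y) (hYq : Y ≤ q * t) {E : ℝ}
    (hE : Y ^ 2 ≤ E * (q ^ 2 / 2 * (1 - 6 / t ^ 4))) :
    Real.exp (-E) / (4 * q) * 2 ^ (n - 2 * m) ≤ (n - 2 * m).choose (k - s) := by
  have ht := H.le_t
  have ht0 := H.t_pos
  have hq0 := H.q_pos
  have hn := H.sq_eq
  have hq1 : 1 ≤ q := by linarith [H.mul_le]
  obtain ⟨hc1, hc2⟩ := half_bounds n
  have ht4 : (300 : ℝ) ^ 4 ≤ t ^ 4 := by gcongr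
  have hmq : (m : ℝ) ≤ q ^ 2 / t ^ 4 := by rw [le_div_iff₀ (by positivity)]; exact hm
  have hqt : q * t ≤ q ^ 2 / t ^ 4 := by
    rw [le_div_iff₀ (by positivity)]
    have h5 : t ^ 5 ≤ q := by
      refine le_trans ?_ H.pow_le
      exact pow_le_pow_right₀ (by linarith) (by norm_num)
    calc q * t * t ^ 4 = q * t ^ 5 := by ring
      _ ≤ q * q := by gcongr
      _ = q ^ 2 := by ring
  have hq1' : 1 ≤ q * t := by nlinarith
  have hD : q ^ 2 / 2 * (1 - 6 / t ^ 4) = q ^ 2 / 2 - 3 * (q ^ 2 / t ^ 4) := by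
    field_simp; ring
  have hsmall : q ^ 2 / t ^ 4 ≤ q ^ 2 / 100 := by
    gcongr; linarith
  have hmn : m ≤ n / 2 := by
    have : (m : ℝ) ≤ (n / 2 : ℕ) := by nlinarith
    exact_mod_cast this
  have hh : (n - 2 * m) / 2 = n / 2 - m := by omega
  have hcast : ((n / 2 - m : ℕ) : ℝ) = (n / 2 : ℕ) - m := by push_cast [hmn]; ring
  have hhY : q ^ 2 / 2 * (1 - 6 / t ^ 4) ≤ ((n / 2 - m : ℕ) : ℝ) - Y := by
    rw [hcast, hD]; linarith
  have hDpos : 0 < q ^ 2 / 2 * (1 - 6 / t ^ 4) := by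
    rw [hD]; nlinarith
  have hY0 : 1 ≤ Y := by
    linarith [abs_nonneg ((k : ℝ) - (n / 2 : ℕ)), abs_nonneg ((s : ℝ) - (m - 1))]
  have hh1 : 1 ≤ n / 2 - m := by
    have : (1 : ℝ) ≤ (n / 2 - m : ℕ) := by linarith
    exact_mod_cast this
  have hE0 : 0 ≤ E := by
    by_contra! hneg
    nlinarith [sq_nonneg Y]
  refine le_trans ?_ (exp_div_mul_two_pow_le_choose hh hh1 (Y := Y) ?_ (by linarith))
  · have hsq : √((n / 2 - m : ℕ) : ℝ) ≤ q := by
      refine Real.sqrt_le_iff.2 ⟨hq0.le, ?_⟩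
      rw [hcast]
      have : (0 : ℝ) ≤ m := by positivity
      nlinarith
    have hsq0 : 0 < √((n / 2 - m : ℕ) : ℝ) := Real.sqrt_pos.2 (by exact_mod_cast hh1)
    have hfrac : Y ^ 2 / (((n / 2 - m : ℕ) : ℝ) - Y) ≤ E := by
      rw [div_le_iff₀ (by linarith)]
      exact hE.trans (by gcongr)
    gcongr
  · rw [hcast, Nat.cast_sub hsk]
    have : (k : ℝ) - s - ((n / 2 : ℕ) - m) = (k - (n / 2 : ℕ)) - (s - (m - 1)) + 1 := by ring
    rw [this]
    refine (abs_add_le _ _).trans ?_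
    have := abs_sub ((k : ℝ) - (n / 2 : ℕ)) (s - (m - 1))
    rw [abs_one]; linarith

theorem exp_half_le_choose_sub (H : IsLarge n t q) {m k s : ℕ} {Y : ℝ}
    (hm : (m : ℝ) * t ^ 4 ≤ q ^ 2) (hsk : s ≤ k)
    (hY : |(k : ℝ) - (n / 2 : ℕ)| + |(s : ℝ) - (m - 1)| + 1 ≤ Y) (hYb : Y ≤ bnd n + q / 16) :
    Real.exp (t / 2) / n * 2 ^ (n - 2 * m) ≤ (n - 2 * m).choose (k - s) := by
  have ht := H.le_t
  have ht0 := H.t_pos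
  have hq0 := H.q_pos
  have hb := H.bnd_le
  have hb2 := H.bnd_sq
  have hqt0 : q * 300 ≤ q * t := by gcongr
  have hY0 : 0 ≤ Y := by
    linarith [abs_nonneg ((k : ℝ) - (n / 2 : ℕ)), abs_nonneg ((s : ℝ) - (m - 1))]
  refine le_trans ?_ (H.exp_div_mul_two_pow_le_choose_sub hm hsk hY (by linarith)
    (E := t ^ 2 / 2 - 7 / 8 * t + 1) ?_)
  · refine mul_le_mul_of_nonneg_right ?_ (by positivity)
    have h4 : (4 : ℝ) ≤ Real.exp 3 := by linarith [Real.add_one_le_exp (3 : ℝ)]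
    calc Real.exp (t / 2) / n = Real.exp (t / 2) * 4 * Real.exp (-(t ^ 2 / 2)) / (4 * q) := by
          rw [Real.exp_neg, H.exp_eq, ← H.sq_eq]; field_simp
      _ ≤ Real.exp (t / 2) * Real.exp 3 * Real.exp (-(t ^ 2 / 2)) / (4 * q) := by gcongr
      _ ≤ _ := by
          rw [← Real.exp_add, ← Real.exp_add]
          gcongr
          linarith
  · calc Y ^ 2 ≤ (bnd n + q / 16) ^ 2 := by gcongr
      _ = q ^ 2 * (t ^ 2 - 2 * t) / 4 + q / 8 * bnd n + q ^ 2 / 256 := by rw [← hb2]; ring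
      _ ≤ q ^ 2 * (t ^ 2 - 2 * t) / 4 + q / 8 * (q * t / 2) + q ^ 2 / 256 := by gcongr
      _ = q ^ 2 / 2 * (t ^ 2 / 2 - 7 / 8 * t + 1 / 128) := by ring
      _ ≤ q ^ 2 / 2 * ((t ^ 2 / 2 - 7 / 8 * t + 1) * (1 - 6 / t ^ 4)) := by
          gcongr
          have h2 : (300 : ℝ) ^ 2 ≤ t ^ 2 := by gcongr
          have : (t ^ 2 / 2 - 7 / 8 * t + 1) * (6 / t ^ 4) ≤ 1 / 2 := by
            calc (t ^ 2 / 2 - 7 / 8 * t + 1) * (6 / t ^ 4) ≤ t ^ 2 * (6 / t ^ 4) := by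
                  gcongr; linarith
              _ = 6 / t ^ 2 := by field_simp
              _ ≤ 1 / 2 := by rw [div_le_iff₀ (by positivity)]; linarith
          linarith
      _ = _ := by ring

theorem inv_le_choose_sub (H : IsLarge n t q) {m k s : ℕ} (hm : (m : ℝ) * t ^ 4 ≤ q ^ 2)
    (hsk : s ≤ k) (hY : |(k : ℝ) - (n / 2 : ℕ)| + |(s : ℝ) - (m - 1)| + 1 ≤ q / 16) :
    1 / (12 * q) * 2 ^ (n - 2 * m) ≤ (n - 2 * m).choose (k - s) := by
  have ht := H.le_t
  have hq0 := H.q_pos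
  have hqt0 : q * 300 ≤ q * t := by gcongr
  have ht4 : (300 : ℝ) ^ 4 ≤ t ^ 4 := by gcongr
  refine le_trans ?_ (H.exp_div_mul_two_pow_le_choose_sub hm hsk hY (by linarith) (E := 1) ?_)
  · refine mul_le_mul_of_nonneg_right ?_ (by positivity)
    rw [Real.exp_neg, div_le_div_iff₀ (by positivity) (by positivity), one_mul,
      inv_mul_eq_div, le_div_iff₀ (Real.exp_pos 1)]
    have := Real.exp_one_lt_d9
    nlinarith
  · have : 6 / t ^ 4 ≤ 1 / 2 := by rw [div_le_iff₀ (by linarith)]; linarith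
    nlinarith [sq_nonneg q]

/-- The error in the comparison with the uniform distribution is negligible. -/
theorem abs_gprob_sub_le (H : IsLarge n t q) (Sd : Set (Fin (delta1 n) → ZMod 2))
    (Su : Set (Fin (delta2 n) → ZMod 2)) :
    |gprob {G : SimpleGraph (Fin n) | Ydown G ∈ Sd ∧ Yup G ∈ Su ∧
        (Zsum G % 4 = 0 ∨ Zsum G % 4 = 1)} -
      (Nat.card Sd / 2 ^ delta1 n) * (Nat.card Su / 2 ^ delta2 n) / 2| ≤ 10 / (n : ℝ) ^ 2 := by
  have ht := H.le_t
  have ht0 := H.t_pos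
  have hq0 := H.q_pos
  have hn := H.sq_eq
  have hqt := H.mul_le
  have hn0 : (0 : ℝ) < n := by rw [← hn]; positivity
  have hqtn : q * (10 ^ 6 * t) ≤ n := by
    rw [← hn, sq]
    gcongr
  have hqt0 : q * 300 ≤ q * t := by gcongr
  have hb1 := H.bnd_le
  have hb2 := H.le_bnd
  have hb0 := bnd_nonneg n
  have hbn : bnd n ≤ n / 100 := by linarith
  have hqn : q ≤ n / 100 := by linarith
  have hn1 : (1 : ℝ) ≤ n := by linarith
  obtain ⟨hc1, hc2⟩ := half_bounds n
  obtain ⟨lo, hi, hlo, hhi, hlo1, hlo2, hhi1, hhi2⟩ := H.exists_endpoints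
  have ht4 : (300 : ℝ) ^ 4 ≤ t ^ 4 := by gcongr
  set m := ⌊q ^ 2 / t ^ 4⌋₊ with hmdef
  set r := ⌊q / 64⌋₊ with hrdef
  have hqt4 : t ^ 4 * 10 ^ 6 ≤ q ^ 2 := by
    have h1 : t ^ 4 ≤ t ^ 8 := pow_le_pow_right₀ (by linarith) (by norm_num)
    have h2 := H.pow_le
    nlinarith
  have hX : 10 ^ 6 ≤ q ^ 2 / t ^ 4 := by
    rw [le_div_iff₀ (by positivity)]; linarith
  have hm1 : (m : ℝ) ≤ q ^ 2 / t ^ 4 := Nat.floor_le (by positivity)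
  have hm2 : q ^ 2 / t ^ 4 < m + 1 := Nat.lt_floor_add_one _
  have hr1 : (r : ℝ) ≤ q / 64 := Nat.floor_le (by positivity)
  have hr2 : q / 64 < r + 1 := Nat.lt_floor_add_one _
  have hmt : (m : ℝ) * t ^ 4 ≤ q ^ 2 := by rwa [le_div_iff₀ (by positivity)] at hm1
  have hmsmall : (m : ℝ) ≤ n / 100 := by
    rw [← hn]
    refine hm1.trans ?_
    gcongr; linarith
  have hrq : q / 128 ≤ r := by linarith
  have hmq : q ^ 2 / (2 * t ^ 4) ≤ m := by
    have : q ^ 2 / (2 * t ^ 4) = q ^ 2 / t ^ 4 / 2 := by field_simp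
    rw [this]; linarith
  have hm0 : (0 : ℝ) < m := by linarith
  have hlc : lo + r ≤ n / 2 := by
    have : (lo : ℝ) + r ≤ (n / 2 : ℕ) := by linarith
    exact_mod_cast this
  have hch : n / 2 ≤ hi := by
    have : ((n / 2 : ℕ) : ℝ) ≤ hi := by linarith
    exact_mod_cast this
  have hin : hi ≤ n := by
    have : (hi : ℝ) ≤ n := by linarith
    exact_mod_cast this
  have hm2' : 2 ≤ m := by
    have : (2 : ℝ) ≤ m := by linarith
    exact_mod_cast this
  have hmn : m * 2 ≤ n := by
    have : (m : ℝ) * 2 ≤ n := by linarith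
    exact_mod_cast this
  have hsk {s k : ℕ} (hs : |(s : ℝ) - (m - 1)| ≤ r) (hk : lo ≤ k) : s ≤ k := by
    have hk' : (lo : ℝ) ≤ k := by exact_mod_cast hk
    have := (abs_le.1 hs).2
    have : (s : ℝ) ≤ k := by linarith
    exact_mod_cast this
  have hmain := _root_.abs_gprob_sub_le (r := r) hlo hhi hlc hch hin hm2' hmn
    (p₁ := Real.exp (t / 2) / n) (p₂ := 1 / (12 * q)) (by positivity) (by positivity) ?_ ?_ Sd Su
  · refine hmain.trans ?_
    have hexp : Real.exp (-(3 * t ^ 2)) = 1 / (n : ℝ) ^ 3 := by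
      rw [Real.exp_neg, ← hn, ← H.exp_eq, ← Real.exp_nat_mul, ← Real.exp_nat_mul, one_div]
      congr 2
      push_cast; ring
    have h1 : Real.exp (-((r : ℝ) ^ 2 / m)) ≤ 1 / (n : ℝ) ^ 3 := by
      rw [← hexp, Real.exp_le_exp, neg_le_neg_iff, le_div_iff₀ hm0]
      calc 3 * t ^ 2 * m ≤ 3 * t ^ 2 * (q ^ 2 / t ^ 4) := by gcongr
        _ = 3 * q ^ 2 / t ^ 2 := by field_simp
        _ ≤ (q / 128) ^ 2 := by
          rw [div_le_iff₀ (by positivity)]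
          have : (300 : ℝ) ^ 2 ≤ t ^ 2 := by gcongr
          nlinarith [sq_nonneg q]
        _ ≤ (r : ℝ) ^ 2 := by gcongr
    have h2 : Real.exp (-(Real.exp (t / 2) / n * (1 / (12 * q)) * r * m)) ≤ 1 / (n : ℝ) ^ 3 := by
      rw [← hexp, Real.exp_le_exp, neg_le_neg_iff]
      calc 3 * t ^ 2 ≤ 30720 * t ^ 6 / (3072 * t ^ 4) := by
            rw [le_div_iff₀ (by positivity)]
            have : 0 ≤ t ^ 6 := by positivity
            nlinarith
        _ ≤ Real.exp (t / 2) / (3072 * t ^ 4) := by gcongr; exact H.le_exp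
        _ = Real.exp (t / 2) / n * (1 / (12 * q)) * (q / 128) * (q ^ 2 / (2 * t ^ 4)) := by
            rw [← hn]; field_simp; norm_num
        _ ≤ _ := by gcongr
    calc 4 * m * Real.exp (-((r : ℝ) ^ 2 / m)) +
          3 * (n + 1) * Real.exp (-(Real.exp (t / 2) / n * (1 / (12 * q)) * r * m))
        ≤ 4 * n * (1 / (n : ℝ) ^ 3) + 3 * (n + n) * (1 / (n : ℝ) ^ 3) := by
          gcongr; linarith
      _ = 10 / (n : ℝ) ^ 2 := by field_simp; norm_num
  · intro s k hs hk hk'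
    have hs' := hsk hs hk
    have hk1 : (lo : ℝ) ≤ k := by exact_mod_cast hk
    have hk2 : (k : ℝ) ≤ hi + r := by exact_mod_cast hk'
    refine ⟨hs', H.exp_half_le_choose_sub hmt hs' (Y := bnd n + q / 16) ?_ le_rfl⟩
    have : |(k : ℝ) - (n / 2 : ℕ)| ≤ bnd n + r + 1 := by rw [abs_le]; constructor <;> linarith
    linarith
  · intro s k hs hk hk'
    have hk1 : ((n / 2 : ℕ) : ℝ) - r ≤ k := by
      rw [sub_le_iff_le_add]; exact_mod_cast (by omega : n / 2 ≤ k + r)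
    have hk2 : (k : ℝ) ≤ (n / 2 : ℕ) := by exact_mod_cast hk'.le
    refine H.inv_le_choose_sub hmt (hsk hs (by omega)) ?_
    have : |(k : ℝ) - (n / 2 : ℕ)| ≤ r := by rw [abs_le]; constructor <;> linarith
    linarith

end IsLarge

end Asymptotics

section Limits

namespace IsLarge

variable {n : ℕ} {t q : ℝ}

theorem le_bnd' (H : IsLarge n t q) : q * (t - 2) / 2 ≤ bnd n := by
  have ht := H.le_t
  refine abs_le_of_sq_le_sq' ?_ (bnd_nonneg n) |>.2
  rw [H.bnd_sq]
  nlinarith [mul_nonneg (sq_nonneg q) (by linarith : 0 ≤ t - 2)]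

theorem abs_delta_div_sub_le (H : IsLarge n t q) {δ : ℝ} (hδ : |δ - bnd n| ≤ 2) :
    |(δ + 1) / (q * t) - 1 / 2| ≤ 2 / t := by
  have ht := H.t_pos
  have ht' := H.le_t
  have hq := H.q_pos
  have hqt := H.mul_le
  have hb1 := H.bnd_le
  have hb2 := H.le_bnd'
  have hqt0 : 0 < q * t := by positivity
  have : (δ + 1) / (q * t) - 1 / 2 = (δ + 1 - q * t / 2) / (q * t) := by field_simp
  rw [this, abs_div, abs_of_pos hqt0, div_le_div_iff₀ hqt0 ht, ← mul_assoc]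
  gcongr
  obtain ⟨h1, h2⟩ := abs_le.1 hδ
  rw [abs_le]
  constructor <;> linarith

theorem abs_delta1_sub_le (H : IsLarge n t q) : |(delta1 n : ℝ) - bnd n| ≤ 2 := by
  obtain ⟨lo, hi, hlo, hhi, hlo1, hlo2, hhi1, hhi2⟩ := H.exists_endpoints
  obtain ⟨hc1, hc2⟩ := half_bounds n
  have hb := H.le_bnd
  have hq := H.mul_le
  have ht := H.le_t
  have hle : lo ≤ n / 2 := by
    have : (lo : ℝ) ≤ (n / 2 : ℕ) := by linarith
    exact_mod_cast this
  have : delta1 n = n / 2 - lo := by rw [delta1, hlo]; omega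
  rw [this, Nat.cast_sub hle, abs_le]
  constructor <;> linarith

theorem abs_delta2_sub_le (H : IsLarge n t q) : |(delta2 n : ℝ) - bnd n| ≤ 2 := by
  obtain ⟨lo, hi, hlo, hhi, hlo1, hlo2, hhi1, hhi2⟩ := H.exists_endpoints
  obtain ⟨hc1, hc2⟩ := half_bounds n
  have hb := H.le_bnd
  have hq := H.mul_le
  have ht := H.le_t
  have hle : n / 2 ≤ hi := by
    have : ((n / 2 : ℕ) : ℝ) ≤ hi := by linarith
    exact_mod_cast this
  have : delta2 n = hi - n / 2 := by rw [delta2, hhi]; omega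
  rw [this, Nat.cast_sub hle, abs_le]
  constructor <;> linarith

end IsLarge

theorem tendsto_sqrt_log_natCast :
    Tendsto (fun n : ℕ => √(Real.log n)) atTop atTop :=
  Real.tendsto_sqrt_atTop.comp (Real.tendsto_log_atTop.comp tendsto_natCast_atTop_atTop)

theorem eventually_isLarge :
    ∀ᶠ n : ℕ in atTop, IsLarge n √(Real.log n) √n := by
  have h1 := (Real.tendsto_exp_div_pow_atTop 8).eventually_ge_atTop 1
  have h2 : ∀ᶠ x : ℝ in atTop, 30720 * x ^ 6 ≤ Real.exp (x / 2) := by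
    have := ((Real.tendsto_exp_div_pow_atTop 6).comp
      (tendsto_id.atTop_div_const (by norm_num : (0 : ℝ) < 2))).eventually_ge_atTop (30720 * 64)
    filter_upwards [this, eventually_gt_atTop 0] with x hx hx0
    simp only [Function.comp_apply, id_eq] at hx
    rw [le_div_iff₀ (by positivity)] at hx
    linarith [(by ring : (30720 * 64 : ℝ) * (x / 2) ^ 6 = 30720 * x ^ 6)]
  filter_upwards [tendsto_sqrt_log_natCast.eventually h1, tendsto_sqrt_log_natCast.eventually h2,
    tendsto_sqrt_log_natCast.eventually_ge_atTop 300, eventually_ge_atTop 1] with n h1 h2 h3 hn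
  have hn0 : (0 : ℝ) < n := by exact_mod_cast hn
  have hlog : 0 ≤ Real.log n := Real.log_nonneg (by exact_mod_cast hn)
  have hexp : Real.exp (√(Real.log n) ^ 2 / 2) = √n := by
    rw [Real.sq_sqrt hlog, ← Real.exp_log (Real.sqrt_pos.2 hn0), Real.log_sqrt hn0.le]
  refine ⟨rfl, Real.sq_sqrt hn0.le, hexp, h3, ?_, h2⟩
  rw [le_div_iff₀ (by positivity), one_mul] at h1
  rw [← hexp]
  refine h1.trans (Real.exp_le_exp.2 ?_)
  nlinarith

theorem tendsto_delta_div {δ : ℕ → ℕ}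
    (hδ : ∀ᶠ n : ℕ in atTop, |(δ n : ℝ) - bnd n| ≤ 2) :
    Tendsto (fun n : ℕ => ((δ n : ℝ) + 1) / (√n * √(Real.log n))) atTop (nhds (1 / 2)) := by
  rw [tendsto_iff_dist_tendsto_zero]
  refine squeeze_zero' (Eventually.of_forall fun _ => dist_nonneg) ?_
    (tendsto_sqrt_log_natCast.const_div_atTop 2)
  filter_upwards [eventually_isLarge, hδ] with n H hn
  exact H.abs_delta_div_sub_le hn

theorem tendsto_log_div_natCast :
    Tendsto (fun n : ℕ => Real.log n / (n : ℝ)) atTop (nhds 0) := by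
  simpa [Function.comp_def] using (Real.tendsto_pow_log_div_mul_add_atTop 1 0 1 one_ne_zero).comp
    tendsto_natCast_atTop_atTop

end Limits

/-- For asymptotically optimal covering codes `S↓`, `S↑` of lengths `δ₁`, `δ₂`, the property
`A_n = {G | Y↓(G) ∈ S↓, Y↑(G) ∈ S↑, Z(G) mod 4 ∈ {0,1}}` satisfies
`n·(ln n)·P[G_n ∈ A_n] → 2`. -/
theorem prob_degree_antistochastic_property
    (Sd : ∀ n : ℕ, Set (Fin (delta1 n) → ZMod 2))
    (Su : ∀ n : ℕ, Set (Fin (delta2 n) → ZMod 2))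
    (hSd : ∀ n, IsCoveringCode (Sd n)) (hSu : ∀ n, IsCoveringCode (Su n))
    (hSdOpt : Tendsto
      (fun n : ℕ => (Nat.card (Sd n) : ℝ) * ((delta1 n : ℝ) + 1) / 2 ^ delta1 n)
      atTop (nhds 1))
    (hSuOpt : Tendsto
      (fun n : ℕ => (Nat.card (Su n) : ℝ) * ((delta2 n : ℝ) + 1) / 2 ^ delta2 n)
      atTop (nhds 1)) :
    Tendsto (fun n : ℕ => (n : ℝ) * Real.log n *
        gprob {G : SimpleGraph (Fin n) |
          Ydown G ∈ Sd n ∧ Yup G ∈ Su n ∧ (Zsum G % 4 = 0 ∨ Zsum G % 4 = 1)})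
      atTop (nhds 2) := by
  have hδ₁ := tendsto_delta_div (eventually_isLarge.mono fun _ H => H.abs_delta1_sub_le)
  have hδ₂ := tendsto_delta_div (eventually_isLarge.mono fun _ H => H.abs_delta2_sub_le)
  have hmain : Tendsto (fun n : ℕ => (n : ℝ) * Real.log n *
      ((Nat.card (Sd n) / 2 ^ delta1 n) * (Nat.card (Su n) / 2 ^ delta2 n) / 2))
      atTop (nhds 2) := by
    have h := ((hSdOpt.div hδ₁ (by norm_num)).mul (hSuOpt.div hδ₂ (by norm_num))).div_const 2
    rw [show (1 / (1 / 2) * (1 / (1 / 2)) / 2 : ℝ) = 2 by norm_num] at h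
    refine h.congr' ?_
    filter_upwards [eventually_isLarge] with n H
    have hq := H.q_pos
    have ht := H.t_pos
    have hsq : (n : ℝ) * Real.log n = (√n * √(Real.log n)) ^ 2 := by
      rw [mul_pow, H.sq_eq, ← H.log_eq]
    rw [hsq]
    simp only [Pi.div_apply]
    field_simp
  have herr : Tendsto (fun n : ℕ => 10 * (Real.log n / (n : ℝ))) atTop (nhds 0) := by
    simpa using tendsto_log_div_natCast.const_mul 10
  refine tendsto_of_tendsto_of_dist hmain (squeeze_zero'
    (Eventually.of_forall fun _ => dist_nonneg) ?_ herr)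
  filter_upwards [eventually_isLarge, eventually_gt_atTop 0] with n H hn
  have hn0 : (0 : ℝ) < n := by exact_mod_cast hn
  have hlog : 0 ≤ Real.log n := by rw [H.log_eq]; positivity
  rw [dist_comm, Real.dist_eq, ← mul_sub, abs_mul, abs_of_nonneg (by positivity)]
  calc _ ≤ (n : ℝ) * Real.log n * (10 / (n : ℝ) ^ 2) := by
        gcongr
        exact H.abs_gprob_sub_le (Sd n) (Su n)
    _ = _ := by field_simp
end

section
/- Let m ≥ 1, let c_1,...,c_m be integers at least one of which is odd, and let b ∈ {0,1}^m. Let R be the set of all r ∈ {0,1,2,3}^m such that r_j ≡ b_j (mod 2) for every j, and let R* be the set of all r ∈ R such that Σ_{j=1}^m c_j·r_j is congruent to 0 or 1 modulo 4. Then |R*| = |R|/2. -/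
/-- If an involution preserves `p` and negates `q`, then exactly half of the elements satisfying
`p` also satisfy `q`. -/
theorem two_mul_card_of_involutive {α : Type*} [Finite α] {f : α → α}
    (hf : Function.Involutive f) {p q : α → Prop} (hp : ∀ x, p x → p (f x))
    (hq : ∀ x, q (f x) ↔ ¬ q x) :
    2 * Nat.card {x | p x ∧ q x} = Nat.card {x | p x} := by
  have himage : f '' {x | p x ∧ q x} = {x | p x ∧ ¬ q x} := by
    ext y
    constructor
    · rintro ⟨x, ⟨hx, hqx⟩, rfl⟩
      exact ⟨hp x hx, by simpa [hq] using hqx⟩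
    · rintro ⟨hy, hqy⟩
      exact ⟨f y, ⟨hp y hy, (hq y).2 hqy⟩, hf y⟩
  have hunion : {x | p x} = {x | p x ∧ q x} ∪ {x | p x ∧ ¬ q x} := by
    ext x
    simp only [Set.mem_ofPred_eq, Set.mem_union]
    tauto
  have hdisj : Disjoint {x | p x ∧ q x} {x | p x ∧ ¬ q x} :=
    Set.disjoint_left.2 fun _ hx hy => hy.2 hx.2
  simp only [Nat.card_coe_set_eq]
  rw [hunion, Set.ncard_union_eq hdisj, ← himage, Set.ncard_image_of_injective _ hf.injective,
    two_mul]

/-- Adding `2` in `Fin 4` changes the representing integer by an odd multiple of `2`. -/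
theorem fin_four_val_add_two (a : Fin 4) :
    (((a + 2 : Fin 4) : ℕ) : ℤ) = (a : ℕ) + 2 ∨ (((a + 2 : Fin 4) : ℕ) : ℤ) = (a : ℕ) - 2 := by
  revert a
  decide

/-- Adding `2` at an index with odd coefficient changes the weighted sum by `2` modulo `4`. -/
theorem sum_update_add_two_emod_four {ι : Type*} [Fintype ι] [DecidableEq ι] (c : ι → ℤ) {i : ι}
    (hi : Odd (c i)) (r : ι → Fin 4) :
    (∑ j, c j * ((Function.update r i (r i + 2) j : ℕ) : ℤ)) % 4 =
      (∑ j, c j * ((r j : ℕ) : ℤ) + 2) % 4 := by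
  have hrest : ∑ j ∈ Finset.univ.erase i, c j * ((Function.update r i (r i + 2) j : ℕ) : ℤ) =
      ∑ j ∈ Finset.univ.erase i, c j * ((r j : ℕ) : ℤ) :=
    Finset.sum_congr rfl fun j hj => by rw [Function.update_of_ne (Finset.ne_of_mem_erase hj)]
  rw [← Finset.add_sum_erase _ _ (Finset.mem_univ i), hrest,
    ← Finset.add_sum_erase _ (fun j => c j * ((r j : ℕ) : ℤ)) (Finset.mem_univ i),
    Function.update_self]
  obtain ⟨k, hk⟩ := hi
  rcases fin_four_val_add_two (r i) with h | h <;> rw [h]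
  · rw [mul_add]
    omega
  · rw [mul_sub]
    omega


/-- Let `c_1, …, c_m` be integers at least one of which is odd and `b ∈ {0,1}^m`. Among the
sequences `r ∈ {0,1,2,3}^m` with `r_j ≡ b_j (mod 2)` for all `j`, exactly half satisfy
`Σ c_j·r_j ≡ 0 or 1 (mod 4)`. -/
theorem half_of_residue_sequences (m : ℕ) (hm : 1 ≤ m) (c : Fin m → ℤ)
    (hodd : ∃ j, Odd (c j)) (b : Fin m → ZMod 2) :
    2 * Nat.card {r : Fin m → Fin 4 |
        (∀ j, ((r j : ℕ) : ZMod 2) = b j) ∧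
        ((∑ j, c j * ((r j : ℕ) : ℤ)) % 4 = 0 ∨ (∑ j, c j * ((r j : ℕ) : ℤ)) % 4 = 1)} =
      Nat.card {r : Fin m → Fin 4 | ∀ j, ((r j : ℕ) : ZMod 2) = b j} := by
  obtain ⟨i, hi⟩ := hodd
  refine two_mul_card_of_involutive (f := fun r => Function.update r i (r i + 2)) ?_ ?_ ?_
  · intro r
    have h : ∀ a : Fin 4, a + 2 + 2 = a := by decide
    simp [h]
  · intro r hr j
    have h : ∀ a : Fin 4, (((a + 2 : Fin 4) : ℕ) : ZMod 2) = ((a : ℕ) : ZMod 2) := by decide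
    rcases eq_or_ne j i with rfl | hj
    · rw [Function.update_self, h, hr]
    · rw [Function.update_of_ne hj, hr]
  · intro r
    rw [sum_update_add_two_emod_four c hi r]
    omega
end
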